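/- arXiv:2512.19645 — 2 statements merged into one kernel-verified Lean document; each statement's English description precedes it below -/
import Mathlib

section
/- Let G = H₁ *_A H₂ be a cyclically amalgamated free product, where H₁ and H₂ are finitely generated groups of rank at least 2 and A is infinite cyclic, embedded as a proper subgroup of each factor, with malnormal image in G. If H₁ and H₂ are both 2-free products of cyclics, then G is a 2-free product of cyclics; in particular every subgroup of G generated by at most 2 elements is isomorphic to a free product of at most 2 cyclic groups. -/
/-- A group `K` is (isomorphic to) a free product of at most `n` cyclic groups.
Every cyclic group is isomorphic to `Multiplicative (ZMod m)` for some `m : ℕ`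
(with `m = 0` giving the infinite cyclic group), so we use these as canonical
representatives of the cyclic factors. -/
def IsFreeProductOfAtMostCyclics (n : ℕ) (K : Type*) [Group K] : Prop :=
  ∃ (k : ℕ) (m : Fin k → ℕ), k ≤ n ∧
    Nonempty (K ≃* Monoid.CoprodI (fun i : Fin k => Multiplicative (ZMod (m i))))

/-- A group `K` is an `n`-free product of cyclics if every subgroup of `K` generated
by at most `n` elements is a free product of at most `n` cyclic groups. -/
def IsNFreeProductOfCyclics (n : ℕ) (K : Type*) [Group K] : Prop :=
  ∀ x : Fin n → K,
    IsFreeProductOfAtMostCyclics n ↥(Subgroup.closure (Set.range x))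

/-- A subgroup `M` of `G` is malnormal if `gMg⁻¹ ∩ M = {1}` for every `g ∉ M`. -/
def Subgroup.IsMalnormal {G : Type*} [Group G] (M : Subgroup G) : Prop :=
  ∀ g : G, g ∉ M → ∀ x ∈ M, g * x * g⁻¹ ∈ M → x = 1

/-- An action of `G` by isometries on the vertex set of a tree, presented through the integer
valued distance function of the tree. The action preserves the bipartition of the tree and an
element fixing two distinct edges with a common endpoint is trivial. -/
structure TreeAction (G V : Type*) [Group G] [MulAction G V] where
  /-- The distance function of the tree. -/
  d : V → V → ℕ
  eq_zero : ∀ x y, d x y = 0 ↔ x = y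
  comm : ∀ x y, d x y = d y x
  tri : ∀ x y z, d x z ≤ d x y + d y z
  smul : ∀ (g : G) x y, d (g • x) (g • y) = d x y
  exists_toward : ∀ x z, x ≠ z → ∃ u, d x u = 1 ∧ d u z + 1 = d x z
  toward_unique : ∀ x z u v, d x u = 1 → d x v = 1 → d u z + 1 = d x z → d v z + 1 = d x z → u = v
  adj_ne : ∀ x u z, d x u = 1 → d u z ≠ d x z
  even : ∀ (g : G) x, Even (d x (g • x))
  fix_two_edges : ∀ (g : G) x y z, d x y = 1 → d x z = 1 → y ≠ z →
    g • x = x → g • y = y → g • z = z → g = 1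

namespace TreeAction

variable {G V : Type*} [Group G] [MulAction G V] (T : TreeAction G V)

theorem d_self (x : V) : T.d x x = 0 := (T.eq_zero x x).2 rfl

theorem pos {x y : V} (h : x ≠ y) : 0 < T.d x y :=
  Nat.pos_of_ne_zero fun h0 => h ((T.eq_zero x y).1 h0)

theorem adj_cases {x u : V} (h : T.d x u = 1) (z : V) :
    T.d u z + 1 = T.d x z ∨ T.d x z + 1 = T.d u z := by
  have h1 := T.tri x u z
  have h2 := T.tri u x z
  have h3 := T.comm u x
  have h4 := T.adj_ne x u z h
  omega

theorem d_smul_left (g : G) (x y : V) : T.d (g • x) y = T.d x (g⁻¹ • y) := by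
  rw [← T.smul g⁻¹, inv_smul_smul]

theorem d_smul_right (g : G) (x y : V) : T.d x (g • y) = T.d (g⁻¹ • x) y := by
  rw [← T.smul g⁻¹, inv_smul_smul]

theorem d_inv_smul (g : G) (x : V) : T.d x (g⁻¹ • x) = T.d x (g • x) := by
  rw [T.d_smul_right, inv_inv, T.comm]

/-- Geodesics between points on different sides of an edge cross that edge. -/
theorem cross {u v : V} (h : T.d u v = 1) {y z : V} (hz : T.d z v + 1 = T.d z u)
    (hy : T.d y u + 1 = T.d y v) : T.d z y = T.d z v + 1 + T.d u y := by
  induction hn : T.d z v generalizing z with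
  | zero =>
    obtain rfl := (T.eq_zero z v).1 hn
    have := T.comm z y
    have := T.comm u y
    omega
  | succ n ih =>
    have hzv : z ≠ v := by
      rintro rfl
      simp [T.d_self] at hn
    obtain ⟨w, hw1, hw2⟩ := T.exists_toward z v hzv
    have e1 := T.tri w v u
    have e2 := T.comm u v
    have e3 := T.adj_cases hw1 u
    have hwy := ih (z := w) (by omega) (by omega)
    rcases T.adj_cases hw1 y with h' | h'
    · omega
    · exfalso
      have e4 := T.comm w z
      by_cases hwv : w = v
      · subst hwv
        have e5 := T.comm u y
        have e6 := T.comm w y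
        have e7 := T.comm u w
        have : z = u := T.toward_unique w y z u (by omega) (by omega) (by omega) (by omega)
        subst this
        rw [T.d_self] at hz
        omega
      · obtain ⟨w', h1, h2⟩ := T.exists_toward w v hwv
        have e5 := T.tri w' v u
        have e6 := T.adj_cases h1 u
        have h3 : T.d w' y + 1 = T.d w y := by
          have e7 := T.adj_cases h1 y
          have e8 := T.tri w' v y
          have e9 := T.tri v u y
          omega
        have := T.toward_unique w y z w' (by omega) h1 (by omega) h3
        subst this
        omega

/-- If `p` and `q` lie behind an edge, then all points in front of the edge agree on which of
`p` and `q` is closer, and by how much. -/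
theorem side_const {u v : V} (h : T.d u v = 1) {p q z : V} (hp : T.d p u + 1 = T.d p v)
    (hq : T.d q u + 1 = T.d q v) (hz : T.d z v + 1 = T.d z u) :
    T.d z p + T.d v q = T.d z q + T.d v p := by
  have h1 := T.cross h hz hp
  have h2 := T.cross h hz hq
  have := T.comm u p
  have := T.comm u q
  have := T.comm v p
  have := T.comm v q
  omega

/-- A neighbour of `x` not pointing towards `z` points away from `z`. -/
theorem away {x u v z : V} (hu : T.d x u = 1) (hv : T.d x v = 1) (hz : T.d u z + 1 = T.d x z)
    (huv : u ≠ v) : T.d v z = T.d x z + 1 := by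
  rcases T.adj_cases hv z with h | h
  · exact absurd (T.toward_unique x z u v hu hv hz h) huv
  · omega

/-- Concatenating geodesics that leave `y` in different directions gives a geodesic. -/
theorem concat {x y z u v : V} (hu : T.d y u = 1) (hv : T.d y v = 1) (hx : T.d u x + 1 = T.d y x)
    (hz : T.d v z + 1 = T.d y z) (huv : u ≠ v) : T.d x z = T.d x y + T.d y z := by
  have h1 := T.away hu hv hx huv
  have h2 := T.comm x v
  have h3 := T.comm x y
  have h4 := T.comm z v
  have h5 := T.comm z y
  have h6 := T.cross (u := y) (v := v) hv (z := z) (y := x) (by omega) (by omega)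
  rw [T.comm z x] at h6
  omega

/-- If `x, y, z` is not geodesic at `y`, then a neighbour of `y` towards `x` is
also towards `z`. -/
theorem toward_of_not_concat {x y z u : V} (hu : T.d y u = 1) (hx : T.d u x + 1 = T.d y x)
    (h : T.d x z ≠ T.d x y + T.d y z) : T.d u z + 1 = T.d y z := by
  have hyz : y ≠ z := by
    rintro rfl
    simp [T.d_self] at h
  obtain ⟨v, hv1, hv2⟩ := T.exists_toward y z hyz
  by_cases huv : u = v
  · subst huv
    exact hv2
  · exact absurd (T.concat hu hv1 hx hv2 huv) h

/-- Points on a common geodesic at the same distance from its origin coincide. -/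
theorem eq_of_between {x p q z : V} (hpq : T.d x p = T.d x q)
    (hp : T.d x z = T.d x p + T.d p z) (hq : T.d x z = T.d x q + T.d q z) : p = q := by
  induction hn : T.d p z generalizing z with
  | zero =>
    have h : T.d q z = 0 := by omega
    rw [(T.eq_zero p z).1 hn, (T.eq_zero q z).1 h]
  | succ n ih =>
    have hzp : z ≠ p := by
      rintro rfl
      simp [T.d_self] at hn
    have hzq : z ≠ q := by
      rintro rfl
      simp [T.d_self] at hq
      omega
    obtain ⟨u, hu1, hu2⟩ := T.exists_toward z p hzp
    obtain ⟨v, hv1, hv2⟩ := T.exists_toward z q hzq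
    have c1 := T.comm z p
    have c2 := T.comm z q
    have c3 := T.comm z x
    have c4 := T.comm u x
    have c5 := T.comm v x
    have c6 := T.comm u p
    have c7 := T.comm v q
    have a1 := T.adj_cases hu1 x
    have a2 := T.adj_cases hv1 x
    have t1 := T.tri x p u
    have t2 := T.tri x q v
    obtain rfl := T.toward_unique z x u v hu1 hv1 (by omega) (by omega)
    exact ih (z := u) (by omega) (by omega) (by omega)

theorem fix_toward {g : G} {x z u : V} (hx : g • x = x) (hz : g • z = z) (hu : T.d x u = 1)
    (huz : T.d u z + 1 = T.d x z) : g • u = u := by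
  apply T.toward_unique x z
  · rw [← hx, T.smul, hu]
  · exact hu
  · conv_lhs => rw [← hz, T.smul]
    exact huz
  · exact huz

theorem eq_one_of_fix_far {g : G} {x z : V} (hx : g • x = x) (hz : g • z = z)
    (h : 2 ≤ T.d x z) : g = 1 := by
  have hxz : x ≠ z := by
    rintro rfl
    simp [T.d_self] at h
  obtain ⟨u, hu1, hu2⟩ := T.exists_toward x z hxz
  have huz : u ≠ z := by
    rintro rfl
    simp [T.d_self] at hu2
    omega
  obtain ⟨v, hv1, hv2⟩ := T.exists_toward u z huz
  have hgu := T.fix_toward hx hz hu1 hu2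
  refine T.fix_two_edges g u x v ?_ hv1 ?_ hgu hx (T.fix_toward hgu hz hv1 hv2)
  · rw [T.comm, hu1]
  · rintro rfl
    omega

/-- If a nontrivial power of `g` fixes an edge at a vertex fixed by `g`, then so does `g`. -/
theorem fix_of_zpow_fix {g : G} {x y : V} {k : ℤ} (hk : g ^ k ≠ 1) (hx : g • x = x)
    (hxy : T.d x y = 1) (hy : g ^ k • y = y) : g • y = y := by
  by_contra hne
  refine hk (T.fix_two_edges (g ^ k) x y (g • y) hxy ?_ (Ne.symm hne) ?_ hy ?_)
  · rw [← hxy, ← T.smul g x y, hx]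
  · exact (MulAction.stabilizer G x).zpow_mem (show g ∈ MulAction.stabilizer G x from hx) k
  · rw [smul_smul, ← (Commute.refl g).zpow_right k |>.eq, ← smul_smul, hy]

end TreeAction
namespace TreeAction

variable {G V : Type*} [Group G] [MulAction G V] (T : TreeAction G V)

/-- `T.Axial g x u v` says that `g` moves `x`, that `u` is the neighbour of `x` towards `g⁻¹ • x`,
that `v` is the neighbour of `x` towards `g • x`, and that `u ≠ v`. Thus `g` is hyperbolic and
`x` lies on its axis. -/
structure Axial (g : G) (x u v : V) : Prop where
  moves : g • x ≠ x
  adj_back : T.d x u = 1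
  adj_front : T.d x v = 1
  back : T.d u (g⁻¹ • x) + 1 = T.d x (g⁻¹ • x)
  front : T.d v (g • x) + 1 = T.d x (g • x)
  ne : u ≠ v

/-- The points behind `x`. -/
def behind (x u : V) : Set V := {z | T.d u z + 1 = T.d x z}

/-- The points in front of `g • x`. -/
def ahead (g : G) (x u : V) : Set V := {z | T.d (g • x) z + 1 = T.d (g • u) z}

variable {T} {g h : G} {x u v : V}

namespace Axial

theorem two_le (a : T.Axial g x u v) : 2 ≤ T.d x (g • x) := by
  have h1 := T.pos a.moves.symm
  obtain ⟨r, hr⟩ := T.even g x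
  omega

theorem inv (a : T.Axial g x u v) : T.Axial g⁻¹ x v u where
  moves h := a.moves (by rw [inv_smul_eq_iff] at h; exact h.symm)
  adj_back := a.adj_front
  adj_front := a.adj_back
  back := by simpa using a.front
  front := a.back
  ne := a.ne.symm

theorem adj_smul_back (a : T.Axial g x u v) : T.d (g • x) (g • u) = 1 := by
  rw [T.smul, a.adj_back]

theorem smul_back (a : T.Axial g x u v) : T.d (g • u) x + 1 = T.d x (g • x) := by
  rw [T.d_smul_left, a.back, T.d_inv_smul]

/-- Points ahead of `g • x` are seen from `x` in the direction of `v`. -/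
theorem ahead_subset (a : T.Axial g x u v) : T.ahead g x u ⊆ T.behind x v := by
  intro z hz
  simp only [ahead, behind, Set.mem_ofPred_eq] at hz ⊢
  have h0 := a.two_le
  have h1 := a.smul_back
  have h2 := a.front
  have h3 := a.adj_smul_back
  have c1 := T.comm (g • x) (g • u)
  have c2 := T.comm x (g • u)
  have c3 := T.comm v (g • u)
  have c4 := T.comm v (g • x)
  have hv : T.d v (g • u) + 1 = T.d v (g • x) := by
    rcases T.adj_cases h3 v with h' | h'
    · omega
    · exfalso
      have hne : x ≠ g • u := by
        intro he
        rw [← he, T.d_self] at h1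
        omega
      obtain ⟨w, hw1, hw2⟩ := T.exists_toward x (g • u) hne
      have t := T.tri w (g • u) (g • x)
      have := T.adj_cases hw1 (g • x)
      obtain rfl := T.toward_unique x (g • x) w v hw1 a.adj_front (by omega) a.front
      omega
  have c5 := T.comm (g • x) z
  have c6 := T.comm (g • u) z
  have key := T.side_const (u := g • u) (v := g • x) (p := x) (q := v) (z := z)
    (by omega) (by omega) hv (by omega)
  have c7 := T.comm x z
  have c8 := T.comm v z
  have c9 := T.comm x (g • x)
  omega

theorem disjoint (a : T.Axial g x u v) {z : V} (hz : z ∈ T.ahead g x u) : z ∉ T.behind x u :=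
  fun hz' => a.ne (T.toward_unique x z u v a.adj_back a.adj_front hz' (a.ahead_subset hz))

theorem smul_mem_ahead (a : T.Axial g x u v) {z : V} (hz : z ∉ T.behind x u) :
    g • z ∈ T.ahead g x u := by
  simp only [ahead, behind, Set.mem_ofPred_eq, T.smul] at hz ⊢
  have := T.adj_cases a.adj_back z
  omega

theorem inv_smul_mem_behind (a : T.Axial g x u v) {z : V} (hz : z ∉ T.ahead g x u) :
    g⁻¹ • z ∈ T.behind x u := by
  simp only [ahead, behind, Set.mem_ofPred_eq, ← T.d_smul_left] at hz ⊢
  have := T.adj_cases a.adj_smul_back z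
  omega

theorem pow_smul_mem_ahead (a : T.Axial g x u v) {z : V} (hz : z ∉ T.behind x u) (n : ℕ) :
    g ^ (n + 1) • z ∈ T.ahead g x u := by
  induction n with
  | zero => simpa using a.smul_mem_ahead hz
  | succ n ih =>
    rw [pow_succ', mul_smul]
    exact a.smul_mem_ahead (a.disjoint ih)

theorem inv_pow_smul_mem_behind (a : T.Axial g x u v) {z : V} (hz : z ∉ T.ahead g x u) (n : ℕ) :
    (g ^ (n + 1))⁻¹ • z ∈ T.behind x u := by
  induction n with
  | zero => simpa using a.inv_smul_mem_behind hz
  | succ n ih =>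
    rw [pow_succ, mul_inv_rev, mul_smul]
    exact a.inv_smul_mem_behind fun h => a.disjoint h ih

theorem zpow_smul_mem (a : T.Axial g x u v) {z : V} (hz : z ∉ T.behind x u)
    (hz' : z ∉ T.ahead g x u) {k : ℤ} (hk : k ≠ 0) :
    g ^ k • z ∈ T.behind x u ∪ T.ahead g x u := by
  obtain ⟨n, rfl | rfl⟩ := k.eq_nat_or_neg
  · obtain ⟨m, rfl⟩ := Nat.exists_eq_succ_of_ne_zero (n := n) (by rintro rfl; simp at hk)
    right
    rw [zpow_natCast]
    exact a.pow_smul_mem_ahead hz m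
  · obtain ⟨m, rfl⟩ := Nat.exists_eq_succ_of_ne_zero (n := n) (by rintro rfl; simp at hk)
    left
    rw [zpow_neg, zpow_natCast]
    exact a.inv_pow_smul_mem_behind hz' m

theorem self_notMem (a : T.Axial g x u v) : x ∉ T.behind x u ∧ x ∉ T.ahead g x u := by
  constructor
  · intro h
    simp [behind, T.d_self] at h
  · intro h
    have := a.ahead_subset h
    simp [behind, T.d_self] at this

/-- A neighbour of `x` in a direction other than those of `u` and `v`
is pushed away from itself by all nontrivial powers of `g`. -/
theorem displacement_zpow (a : T.Axial g x u v) {y : V} (hxy : T.d x y = 1) (hyu : y ≠ u)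
    (hyv : y ≠ v) {k : ℤ} (hk : k ≠ 0) : T.d y (g ^ k • y) = T.d x (g ^ k • x) + 2 := by
  have key : ∀ z, z ∈ T.behind x u ∪ T.ahead g x u → T.d y z = T.d x z + 1 := by
    rintro z (hz | hz)
    · exact T.away a.adj_back hxy hz hyu.symm
    · exact T.away a.adj_front hxy (a.ahead_subset hz) hyv.symm
  have hy : y ∉ T.behind x u ∧ y ∉ T.ahead g x u := by
    constructor
    · intro h
      have h' : T.d u y + 1 = T.d x y := h
      exact hyu ((T.eq_zero u y).1 (by omega)).symm
    · intro h
      have h' : T.d v y + 1 = T.d x y := a.ahead_subset h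
      exact hyv ((T.eq_zero v y).1 (by omega)).symm
  have h1 := key _ (a.zpow_smul_mem hy.1 hy.2 hk)
  have h2 := key _ (a.zpow_smul_mem a.self_notMem.1 a.self_notMem.2 (neg_ne_zero.2 hk))
  rw [zpow_neg, ← T.d_smul_left, ← T.d_smul_left, T.comm, T.comm _ x] at h2
  omega

end Axial

variable (T) in
/-- If `u` is the neighbour of `x` both towards `g • x` and towards `g⁻¹ • x`,
then `g` moves `u` less than `x`. -/
theorem d_smul_of_fold (hu1 : T.d x u = 1) (hu2 : T.d u (g⁻¹ • x) + 1 = T.d x (g⁻¹ • x))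
    (hv2 : T.d u (g • x) + 1 = T.d x (g • x)) : T.d x (g • x) = T.d u (g • u) + 2 := by
  have hgu : T.d (g • u) x + 1 = T.d (g • x) x := by
    rw [T.d_smul_left, T.d_smul_left, hu2]
  have hxg : T.d (g • x) (g • u) = 1 := by rw [T.smul, hu1]
  have c1 := T.comm (g • x) x
  have c2 := T.comm (g • u) u
  have c3 := T.comm u (g • x)
  rcases T.adj_cases hxg u with h' | h'
  · omega
  · exfalso
    have he := T.even g x
    have he' := T.even g u
    have e1 := T.adj_cases hu1 (g • u)
    have e2 := T.comm x (g • u)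
    have hne : g • x ≠ u := by
      rintro hgx
      rw [hgx, T.d_self] at c3 hv2
      rw [hgx, ← hv2] at he
      simp at he
    obtain ⟨w, hw1, hw2⟩ := T.exists_toward (g • x) u hne
    have e3 := T.tri w u x
    have e4 := T.comm u x
    have e5 := T.adj_cases hw1 x
    have := T.toward_unique (g • x) x w (g • u) hw1 hxg (by omega) (by omega)
    subst this
    omega

variable (T) in
/-- If `g` moves the end `y` of an edge by more than its other end `x`,
then so do all nontrivial powers of `g`. -/
theorem displacement_zpow {y : V} (hxy : T.d x y = 1)
    (h : T.d y (g • y) = T.d x (g • x) + 2) {k : ℤ} (hk : g ^ k ≠ 1) :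
    T.d y (g ^ k • y) = T.d x (g ^ k • x) + 2 := by
  have hk0 : k ≠ 0 := by
    rintro rfl
    simp at hk
  induction hc : T.d x (g • x) using Nat.strong_induction_on generalizing x y with
  | _ c ih =>
  subst hc
  have hyx : T.d y x = 1 := by rw [T.comm, hxy]
  by_cases hx : g • x = x
  · have hkx : g ^ k • x = x :=
      (MulAction.stabilizer G x).zpow_mem (show g ∈ MulAction.stabilizer G x from hx) k
    have hky : g ^ k • y ≠ y := by
      intro hy
      rw [T.fix_of_zpow_fix hk hx hxy hy, T.d_self] at h
      omega
    have h1 : T.d x (g ^ k • y) = 1 := by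
      conv_lhs => rw [← hkx, T.smul]
      exact hxy
    have := T.away (z := y) hxy h1 (by rw [T.d_self, hxy]) hky.symm
    rw [hkx, T.d_self, T.comm, this, hxy]
  · obtain ⟨v, hv1, hv2⟩ := T.exists_toward x (g • x) (Ne.symm hx)
    obtain ⟨u, hu1, hu2⟩ := T.exists_toward x (g⁻¹ • x)
      (fun h => hx (by rw [eq_inv_smul_iff] at h; exact h))
    have t1 := T.tri y (g • x) (g • y)
    have t2 := T.tri y x (g • y)
    have t3 := T.smul g x y
    have t4 := T.adj_cases hxy (g • x)
    have t5 := T.adj_cases hxy (g⁻¹ • x)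
    have t6 := T.d_inv_smul g x
    have t7 : T.d y (g⁻¹ • x) = T.d x (g • y) := by rw [T.d_smul_right, inv_inv, T.comm]
    have hyv : y ≠ v := by
      rintro rfl
      omega
    have hyu : y ≠ u := by
      rintro rfl
      omega
    by_cases huv : u = v
    · subst huv
      have hfold := T.d_smul_of_fold hu1 hu2 hv2
      have hd := ih _ (by omega) (by rw [T.comm, hu1]) hfold rfl
      have s1 := T.smul (g ^ k) x u
      have s2 := T.smul (g ^ k) x y
      have a1 := T.adj_cases hu1 (g ^ k • x)
      have a2 := T.tri u (g ^ k • u) (g ^ k • x)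
      have a3 := T.comm (g ^ k • u) (g ^ k • x)
      have b1 := T.away (z := g ^ k • x) hu1 hxy (by omega) hyu.symm
      have hgy : g ^ k • u ≠ g ^ k • y := fun he => hyu (smul_left_cancel _ he).symm
      have c4 := T.tri (g ^ k • u) u y
      have c5 := T.tri u x y
      have c6 := T.comm u x
      have c7 := T.comm u (g ^ k • u)
      have c8 := T.comm y (g ^ k • x)
      have a4 := T.adj_cases (x := g ^ k • x) (u := g ^ k • u) (by omega) y
      have b2 := T.away (z := y) (x := g ^ k • x) (u := g ^ k • u) (v := g ^ k • y)
        (by omega) (by omega) (by omega) hgy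
      rw [T.comm y, b2]
      omega
    · exact Axial.displacement_zpow ⟨hx, hu1, hv1, hu2, hv2, huv⟩ hxy hyu hyv hk0

end TreeAction
/-- Ping-pong for two cyclic groups and a set `Y` together with its complement. -/
theorem isFreeProductOfAtMostCyclics_of_pingPong {G α : Type*} [Group G] [MulAction G α] (g h : G)
    (Y : Set α) (x : α) (hx : x ∉ Y) (hgx : ∀ k : ℤ, g ^ k ≠ 1 → g ^ k • x ∉ Y)
    (hgY : ∀ k : ℤ, g ^ k ≠ 1 → ∀ z ∈ Y, g ^ k • z ∉ Y)
    (hhY : ∀ k : ℤ, h ^ k ≠ 1 → ∀ z ∉ Y, h ^ k • z ∈ Y) :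
    IsFreeProductOfAtMostCyclics 2 (Subgroup.closure {g, h}) := by
  let s : Fin 2 → G := ![g, h]
  let e := fun i => zmodCyclicMulEquiv (G := Subgroup.zpowers (s i)) inferInstance
  let f := fun i => (Subgroup.zpowers (s i)).subtype.comp (e i).toMonoidHom
  have f_inj : ∀ i m, f i m = 1 → m = 1 := fun i m hm =>
    (map_eq_one_iff (e i) (e i).injective).1 (Subtype.ext hm)
  have f_zpow : ∀ i m, ∃ k : ℤ, f i m = s i ^ k := fun i m => by
    obtain ⟨k, hk⟩ := Subgroup.mem_zpowers_iff.1 (e i m).2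
    exact ⟨k, hk.symm⟩
  have f_range : ∀ i, (f i).range = Subgroup.zpowers (s i) := fun i => by
    have htop : (e i).toMonoidHom.range = ⊤ := MonoidHom.range_eq_top.2 (e i).surjective
    rw [MonoidHom.range_comp, htop, ← MonoidHom.range_eq_map, Subgroup.range_subtype]
  have range_eq : (Monoid.CoprodI.lift f).range = Subgroup.closure {g, h} := by
    rw [Monoid.CoprodI.range_eq_iSup]
    simp only [f_range, Subgroup.zpowers_eq_closure, ← Subgroup.closure_iUnion]
    congr 1
    ext z
    simp [s, or_comm]
  have g_step : ∀ m : Multiplicative (ZMod _), m ≠ 1 →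
      f 0 m • x ∉ Y ∧ ∀ z ∈ Y, f 0 m • z ∉ Y := fun m hm => by
    obtain ⟨k, hk⟩ := f_zpow 0 m
    have hk1 : g ^ k ≠ 1 := fun h1 => hm (f_inj 0 m (hk.trans h1))
    rw [hk]
    exact ⟨hgx k hk1, hgY k hk1⟩
  have h_step : ∀ m : Multiplicative (ZMod _), m ≠ 1 → ∀ z ∉ Y, f 1 m • z ∈ Y := fun m hm => by
    obtain ⟨k, hk⟩ := f_zpow 1 m
    have hk1 : h ^ k ≠ 1 := fun h1 => hm (f_inj 1 m (hk.trans h1))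
    rw [hk]
    exact hhY k hk1
  have eq_empty : ∀ w : Monoid.CoprodI.Word fun i => Multiplicative (ZMod (Nat.card
      (Subgroup.zpowers (s i)))), w.fstIdx ≠ some 0 → w.fstIdx ≠ some 1 →
      w = Monoid.CoprodI.Word.empty := by
    intro w h0 h1
    cases w using Monoid.CoprodI.Word.consRecOn with
    | empty => rfl
    | cons i m w hw hm =>
      rw [Monoid.CoprodI.Word.fstIdx_cons] at h0 h1
      fin_cases i
      · exact absurd rfl h0
      · exact absurd rfl h1
  have word_smul : ∀ w : Monoid.CoprodI.Word fun i => Multiplicative (ZMod (Nat.card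
      (Subgroup.zpowers (s i)))),
      w.fstIdx = some 1 ↔ Monoid.CoprodI.lift f w.prod • x ∈ Y := by
    intro w
    induction w using Monoid.CoprodI.Word.consRecOn with
    | empty => simpa [Monoid.CoprodI.Word.fstIdx] using hx
    | cons i m w hw hm ih =>
      rw [Monoid.CoprodI.Word.fstIdx_cons, Monoid.CoprodI.Word.prod_cons, map_mul,
        Monoid.CoprodI.lift_of, mul_smul]
      fin_cases i
      · simp only [Fin.zero_eta, Option.some.injEq, zero_ne_one, false_iff]
        by_cases hw1 : w.fstIdx = some 1
        · exact (g_step m hm).2 _ (ih.1 hw1)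
        · rw [eq_empty w hw hw1, Monoid.CoprodI.Word.prod_empty, map_one, one_smul]
          exact (g_step m hm).1
      · simp only [Fin.mk_one, true_iff]
        exact h_step m hm _ fun hY => hw (ih.2 hY)
  have lift_inj : Function.Injective (Monoid.CoprodI.lift f) := by
    rw [injective_iff_map_eq_one]
    intro w hw
    rw [← Monoid.CoprodI.Word.equiv.symm_apply_apply w] at hw ⊢
    generalize Monoid.CoprodI.Word.equiv w = w at hw ⊢
    change Monoid.CoprodI.lift f w.prod = 1 at hw
    change w.prod = 1
    have hY := word_smul w
    rw [hw, one_smul, iff_false_right hx] at hY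
    cases w using Monoid.CoprodI.Word.consRecOn with
    | empty => simp
    | cons i m w hw' hm =>
      exfalso
      rw [Monoid.CoprodI.Word.prod_cons, map_mul, Monoid.CoprodI.lift_of] at hw
      rw [Monoid.CoprodI.Word.fstIdx_cons] at hY
      fin_cases i
      · have h1 : w.fstIdx ≠ some 1 := by
          rw [Ne, word_smul, eq_inv_of_mul_eq_one_right hw, ← map_inv]
          exact (g_step _ (inv_ne_one.2 hm)).1
        rw [eq_empty w hw' h1, Monoid.CoprodI.Word.prod_empty, map_one, mul_one] at hw
        exact hm (f_inj _ m hw)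
      · exact hY rfl
  exact ⟨2, fun i => Nat.card (Subgroup.zpowers (s i)), le_rfl,
    ⟨((MonoidHom.ofInjective lift_inj).trans (MulEquiv.subgroupCongr range_eq)).symm⟩⟩
namespace TreeAction

variable {G V : Type*} [Group G] [MulAction G V] {T : TreeAction G V} {g h : G} {x u v p q : V}

theorem exists_axial (hx : g • x ≠ x)
    (hfold : ∀ y, T.d x y = 1 → T.d x (g • x) ≠ T.d y (g • y) + 2) :
    ∃ u v, T.Axial g x u v := by
  obtain ⟨v, hv1, hv2⟩ := T.exists_toward x (g • x) (Ne.symm hx)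
  obtain ⟨u, hu1, hu2⟩ := T.exists_toward x (g⁻¹ • x)
    (fun h => hx (by rw [eq_inv_smul_iff] at h; exact h))
  refine ⟨u, v, hx, hu1, hv1, hu2, hv2, ?_⟩
  rintro rfl
  exact hfold u hu1 (T.d_smul_of_fold hu1 hu2 hv2)

theorem Axial.d_back_le (a : T.Axial g x u v) : T.d u (g • u) ≤ T.d x (g • x) := by
  have h1 := a.smul_back
  have h2 := T.tri u x (g • u)
  have h3 := T.comm x u
  have h4 := T.comm x (g • u)
  have h5 := a.adj_back
  omega

variable (T) in
/-- The sum of the displacements of `x` under `g` and `h`. -/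
def disp (g h : G) (x : V) : ℕ := T.d x (g • x) + T.d x (h • x)

variable (T) in
/-- The pair `g, h` together with the base point `x` has minimal total displacement among all
pairs generating the same subgroup and all base points. -/
def IsReduced (g h : G) (x : V) : Prop :=
  ∀ g' h' x', Subgroup.closure {g', h'} = Subgroup.closure {g, h} → T.disp g h x ≤ T.disp g' h' x'

theorem IsReduced.of_le (r : T.IsReduced g h x) {g' h' : G} {x' : V}
    (hc : Subgroup.closure {g', h'} = Subgroup.closure {g, h})
    (hd : T.disp g' h' x' ≤ T.disp g h x) : T.IsReduced g' h' x' :=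
  fun g'' h'' x'' hc' => hd.trans (r g'' h'' x'' (hc'.trans hc))

theorem closure_pair_inv_left (g h : G) :
    Subgroup.closure {g⁻¹, h} = Subgroup.closure {g, h} := by
  refine le_antisymm ?_ ?_ <;> rw [Subgroup.closure_le, Set.insert_subset_iff,
    Set.singleton_subset_iff]
  · exact ⟨inv_mem (Subgroup.subset_closure (by simp)), Subgroup.subset_closure (by simp)⟩
  · refine ⟨?_, Subgroup.subset_closure (by simp)⟩
    rw [← inv_inv g]
    exact inv_mem (Subgroup.subset_closure (by simp))

theorem closure_pair_mul_zpow (g h : G) (k : ℤ) :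
    Subgroup.closure {g, h * g ^ k} = Subgroup.closure {g, h} := by
  have hg : ∀ s : Set G, g ∈ s → ∀ n : ℤ, g ^ n ∈ Subgroup.closure s := fun s hs n =>
    zpow_mem (Subgroup.subset_closure hs) n
  refine le_antisymm ?_ ?_ <;> rw [Subgroup.closure_le, Set.insert_subset_iff,
    Set.singleton_subset_iff]
  · exact ⟨Subgroup.subset_closure (by simp),
      mul_mem (Subgroup.subset_closure (by simp)) (hg _ (by simp) k)⟩
  · refine ⟨Subgroup.subset_closure (by simp), ?_⟩
    have : h = h * g ^ k * g ^ (-k) := by simp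
    rw [this]
    exact mul_mem (Subgroup.subset_closure (by simp)) (hg _ (by simp) (-k))

theorem closure_pair_inv_mul (g h : G) :
    Subgroup.closure {g, g⁻¹ * h} = Subgroup.closure {g, h} := by
  refine le_antisymm ?_ ?_ <;> rw [Subgroup.closure_le, Set.insert_subset_iff,
    Set.singleton_subset_iff]
  · exact ⟨Subgroup.subset_closure (by simp), mul_mem
      (inv_mem (Subgroup.subset_closure (by simp))) (Subgroup.subset_closure (by simp))⟩
  · refine ⟨Subgroup.subset_closure (by simp), ?_⟩
    have : h = g * (g⁻¹ * h) := by simp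
    rw [this]
    exact mul_mem (Subgroup.subset_closure (by simp)) (Subgroup.subset_closure (by simp))

theorem IsReduced.symm (r : T.IsReduced g h x) : T.IsReduced h g x :=
  r.of_le (by rw [Set.pair_comm]) (by simp only [disp]; omega)

theorem IsReduced.inv_left (r : T.IsReduced g h x) : T.IsReduced g⁻¹ h x :=
  r.of_le (closure_pair_inv_left g h) (by simp only [disp, T.d_inv_smul]; omega)

theorem IsReduced.inv_right (r : T.IsReduced g h x) : T.IsReduced g h⁻¹ x :=
  r.symm.inv_left.symm

theorem IsReduced.le_d_right (r : T.IsReduced g h x) : T.d x (h • x) ≤ T.d (g • x) (h • x) := by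
  have h1 := r g (g⁻¹ * h) x (closure_pair_inv_mul g h)
  simp only [disp, mul_smul, ← T.d_smul_left] at h1
  omega

theorem IsReduced.le_d_left (r : T.IsReduced g h x) : T.d x (g • x) ≤ T.d (g • x) (h • x) := by
  rw [T.comm (g • x)]
  exact r.symm.le_d_right

/-- An element moving `y` more than its neighbour `x` moves the side of `y` off itself. -/
theorem smul_notMem_behind {y z : V} {s : G} (hxy : T.d x y = 1)
    (hs : T.d y (s • y) = T.d x (s • x) + 2) (hz : z ∈ T.behind x y) : s • z ∉ T.behind x y := by
  intro hz'
  simp only [behind, Set.mem_ofPred_eq] at hz hz'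
  have h1 := T.smul s x y
  have h2 := T.smul s x z
  have h3 := T.smul s y z
  have t1 := T.tri y (s • x) (s • y)
  have t2 := T.tri y x (s • y)
  have t3 := T.tri x (s • x) (s • y)
  have t4 := T.tri y x (s • x)
  have c1 := T.comm y x
  have c2 := T.comm (s • x) (s • z)
  have c3 := T.comm (s • y) (s • z)
  have c4 := T.comm x (s • z)
  have c5 := T.comm y (s • z)
  have c6 := T.comm (s • y) x
  have c7 := T.comm (s • y) y
  have key := T.side_const (u := s • x) (v := s • y) (p := x) (q := y) (z := s • z)
    (by omega) (by omega) (by omega) (by omega)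
  omega

theorem isFreeProduct_of_fold (r : T.IsReduced g h x) {y : V} (hxy : T.d x y = 1)
    (hf : T.d x (h • x) = T.d y (h • y) + 2) :
    IsFreeProductOfAtMostCyclics 2 (Subgroup.closure {g, h}) := by
  have hyx : T.d y x = 1 := by rw [T.comm, hxy]
  have hg : T.d y (g • y) = T.d x (g • x) + 2 := by
    have h1 : T.disp g h x ≤ T.disp g h y := r g h y rfl
    simp only [disp] at h1
    have t1 := T.tri y x (g • y)
    have t2 := T.tri x (g • x) (g • y)
    have t3 := T.smul g x y
    omega
  have hcompl : ∀ z, z ∉ T.behind x y ↔ z ∈ T.behind y x := by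
    intro z
    simp only [behind, Set.mem_ofPred_eq]
    have := T.adj_cases hxy z
    omega
  refine isFreeProductOfAtMostCyclics_of_pingPong g h (T.behind x y) x ?_ ?_ ?_ ?_
  · intro h'
    simp [behind, T.d_self] at h'
  · intro k hk h'
    have h1 := T.displacement_zpow hxy hg hk
    have h2 := T.tri y (g ^ k • x) (g ^ k • y)
    have h3 := T.smul (g ^ k) x y
    simp only [behind, Set.mem_ofPred_eq] at h'
    omega
  · intro k hk z hz
    exact smul_notMem_behind hxy (T.displacement_zpow hxy hg hk) hz
  · intro k hk z hz
    rw [hcompl] at hz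
    by_contra hz'
    rw [hcompl] at hz'
    exact smul_notMem_behind hyx (T.displacement_zpow hyx hf hk) hz hz'

theorem isFreeProduct_of_fix_of_axial (a : T.Axial h x u v) (hx : g • x = x)
    (huv : ∀ k : ℤ, g ^ k • u ≠ v) (hu : ∀ k : ℤ, g ^ k ≠ 1 → g ^ k • u ≠ u) :
    IsFreeProductOfAtMostCyclics 2 (Subgroup.closure {g, h}) := by
  have hgk : ∀ k : ℤ, g ^ k • x = x := fun k =>
    (MulAction.stabilizer G x).zpow_mem (show g ∈ MulAction.stabilizer G x from hx) k
  have hbehind : ∀ k : ℤ, ∀ z, z ∈ T.behind x u → T.d x (g ^ k • u) = 1 ∧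
      T.d (g ^ k • u) (g ^ k • z) + 1 = T.d x (g ^ k • z) := by
    intro k z hz
    have h1 : T.d x (g ^ k • u) = 1 := by rw [T.d_smul_right, ← zpow_neg, hgk, a.adj_back]
    have h2 : T.d x (g ^ k • z) = T.d x z := by rw [T.d_smul_right, ← zpow_neg, hgk]
    rw [h2, T.smul]
    exact ⟨h1, hz⟩
  have hahead : ∀ z, z ∈ T.ahead h x u → T.d x z = T.d x (h • x) + T.d (h • x) z := by
    intro z hz
    simp only [ahead, Set.mem_ofPred_eq] at hz
    have h1 := a.smul_back
    have c1 := T.comm (h • u) x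
    have c2 := T.comm (h • x) z
    have c3 := T.comm (h • u) z
    have := T.cross (u := h • u) (v := h • x) (z := z) (y := x)
      (by rw [T.comm, a.adj_smul_back]) (by omega) (by omega)
    rw [T.comm x z]
    omega
  have hbx : ∀ k : ℤ, ∀ z ∈ T.behind x u, g ^ k • z ∉ T.ahead h x u := by
    intro k z hz hz'
    have h1 := hbehind k z hz
    exact huv k (T.toward_unique x (g ^ k • z) _ _ h1.1 a.adj_front h1.2 (a.ahead_subset hz'))
  refine isFreeProductOfAtMostCyclics_of_pingPong g h (T.behind x u ∪ T.ahead h x u) x ?_ ?_ ?_ ?_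
  · rintro (h' | h')
    exacts [a.self_notMem.1 h', a.self_notMem.2 h']
  · intro k _
    rw [hgk]
    rintro (h' | h')
    exacts [a.self_notMem.1 h', a.self_notMem.2 h']
  · rintro k hk z (hz | hz) (hz' | hz')
    · have h1 := hbehind k z hz
      exact hu k hk (T.toward_unique x (g ^ k • z) _ _ h1.1 a.adj_back h1.2 hz')
    · exact hbx k z hz hz'
    · refine hbx (-k) _ hz' ?_
      rwa [zpow_neg, inv_smul_smul]
    · have h1 := hahead _ hz
      have h2 := hahead _ hz'
      have h3 : T.d x (g ^ k • h • x) = T.d x (h • x) := by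
        rw [T.d_smul_right, ← zpow_neg, hgk]
      have h4 : T.d x (g ^ k • z) = T.d x z := by
        rw [T.d_smul_right, ← zpow_neg, hgk]
      have h5 := T.smul (g ^ k) (h • x) z
      have h6 : h • x = g ^ k • h • x :=
        T.eq_of_between (x := x) (z := g ^ k • z) (by omega) h2 (by omega)
      exact hk (T.eq_one_of_fix_far (hgk k) h6.symm a.two_le)
  · intro k hk z hz
    exact a.zpow_smul_mem (fun h' => hz (Or.inl h')) (fun h' => hz (Or.inr h'))
      (by rintro rfl; simp at hk)

theorem isFreeProduct_of_reduced_fix_axial (r : T.IsReduced g h x) (a : T.Axial h x u v)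
    (hx : g • x = x) (hu : ∀ k : ℤ, g ^ k ≠ 1 → g ^ k • u ≠ u) :
    IsFreeProductOfAtMostCyclics 2 (Subgroup.closure {g, h}) := by
  by_cases huv : ∃ k : ℤ, g ^ k • u = v
  · obtain ⟨k, hk⟩ := huv
    have hgk : ∀ k : ℤ, g ^ k • x = x := fun k =>
      (MulAction.stabilizer G x).zpow_mem (show g ∈ MulAction.stabilizer G x from hx) k
    have hh : (h * g ^ (-k)) • x = h • x := by rw [mul_smul, hgk]
    have hh' : (h * g ^ (-k))⁻¹ • x = g ^ k • h⁻¹ • x := by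
      rw [mul_inv_rev, zpow_neg, inv_inv, mul_smul]
    rw [← closure_pair_mul_zpow g h (-k)]
    refine isFreeProduct_of_fold (y := v)
      (r.of_le (closure_pair_mul_zpow g h (-k)) (by simp only [disp, hh]; omega)) a.adj_front ?_
    refine T.d_smul_of_fold a.adj_front ?_ ?_
    · rw [hh', ← hk, T.smul, a.back, T.d_smul_right (g ^ k), ← zpow_neg, hgk]
    · rw [hh, a.front]
  · exact isFreeProduct_of_fix_of_axial a hx (not_exists.1 huv) hu

theorem isFreeProduct_of_reduced_fix (r : T.IsReduced g h x) (hx : g • x = x) (hhx : h • x ≠ x) :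
    IsFreeProductOfAtMostCyclics 2 (Subgroup.closure {g, h}) := by
  by_cases hfold : ∃ y, T.d x y = 1 ∧ T.d x (h • x) = T.d y (h • y) + 2
  · obtain ⟨y, hy1, hy2⟩ := hfold
    exact isFreeProduct_of_fold r hy1 hy2
  obtain ⟨u, v, a⟩ := exists_axial hhx fun y hy1 hy2 => hfold ⟨y, hy1, hy2⟩
  by_cases hu : ∀ k : ℤ, g ^ k ≠ 1 → g ^ k • u ≠ u
  · exact isFreeProduct_of_reduced_fix_axial r a hx hu
  push Not at hu
  obtain ⟨k, hk, hku⟩ := hu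
  have hgu : g • u = u := T.fix_of_zpow_fix hk hx a.adj_back hku
  have h1 := a.d_back_le
  have h2 : T.disp g h x ≤ T.disp g h u := r g h u rfl
  have r' : T.IsReduced g h u := r.of_le rfl (by simp only [disp, hx, hgu, T.d_self]; omega)
  simp only [disp, hx, hgu, T.d_self] at h2
  by_cases hfold' : ∃ y, T.d u y = 1 ∧ T.d u (h • u) = T.d y (h • y) + 2
  · obtain ⟨y, hy1, hy2⟩ := hfold'
    exact isFreeProduct_of_fold r' hy1 hy2
  have hhu : h • u ≠ u := by
    intro he
    have h3 := T.pos hhx.symm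
    rw [he, T.d_self u] at h2
    omega
  obtain ⟨u', v', a'⟩ := exists_axial hhu fun y hy1 hy2 => hfold' ⟨y, hy1, hy2⟩
  refine isFreeProduct_of_reduced_fix_axial r' a' hgu fun j hj hju => hj ?_
  have hux : T.d u x = 1 := by rw [T.comm, a.adj_back]
  have hgj : ∀ y : V, g • y = y → g ^ j • y = y := fun y hy =>
    (MulAction.stabilizer G y).zpow_mem (show g ∈ MulAction.stabilizer G y from hy) j
  refine T.fix_two_edges _ u x u' hux a'.adj_back ?_ (hgj u hgu) (hgj x hx) hju
  have h4 := a.smul_back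
  have h5 := T.comm (h • u) x
  have hxv : x = v' := T.toward_unique u (h • u) x v' hux a'.adj_front (by omega) a'.front
  rw [hxv]
  exact a'.ne.symm

theorem d_smul_back_smul_back (r : T.IsReduced g h x) (a : T.Axial g x u v)
    (b : T.Axial h x p q) :
    T.d (g • u) (h • x) + 1 = T.d (g • x) (h • x) ∧
      T.d (h • p) (g • x) + 1 = T.d (g • x) (h • x) ∧
      T.d (g • u) (h • p) + 2 = T.d (g • x) (h • x) := by
  have r1 := r.le_d_left
  have r2 := r.le_d_right
  have a0 := a.two_le
  have b0 := b.two_le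
  have a1 := a.smul_back
  have b1 := b.smul_back
  have c1 := T.comm x (g • x)
  have c2 := T.comm x (h • x)
  have c3 := T.comm (g • x) (h • x)
  have c4 := T.comm x (g • u)
  have c5 := T.comm (h • x) (g • u)
  have c6 := T.comm (h • p) (g • u)
  have e1 := T.toward_of_not_concat (z := h • x) a.adj_smul_back (x := x) (by omega) (by omega)
  have e2 := T.toward_of_not_concat (z := g • x) b.adj_smul_back (x := x) (by omega) (by omega)
  have e3 := T.toward_of_not_concat (z := g • u) b.adj_smul_back (x := x) (by omega) (by omega)
  omega

theorem isFreeProduct_of_axial_axial (r : T.IsReduced g h x) (a : T.Axial g x u v)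
    (b : T.Axial h x p q) (hup : u ≠ p) (huq : u ≠ q) (hvp : v ≠ p) :
    IsFreeProductOfAtMostCyclics 2 (Subgroup.closure {g, h}) := by
  have huniq : ∀ {s t z}, T.d x s = 1 → T.d x t = 1 → s ≠ t → z ∈ T.behind x s →
      z ∉ T.behind x t := fun hs ht hst hz hz' => hst (T.toward_unique x _ _ _ hs ht hz hz')
  have hdisj : ∀ z, z ∈ T.behind x u ∪ T.ahead g x u → z ∉ T.behind x p ∪ T.ahead h x p := by
    rintro z (hz | hz) (hz' | hz')
    · exact huniq a.adj_back b.adj_back hup hz hz'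
    · exact huniq a.adj_back b.adj_front huq hz (b.ahead_subset hz')
    · exact huniq a.adj_front b.adj_back hvp (a.ahead_subset hz) hz'
    · obtain ⟨h1, h2, h3⟩ := d_smul_back_smul_back r a b
      simp only [ahead, Set.mem_ofPred_eq] at hz hz'
      have c1 := T.comm (g • x) z
      have c2 := T.comm (g • u) z
      have c3 := T.comm (h • x) (g • u)
      have c4 := T.comm (h • x) (g • x)
      have c5 := T.comm (h • p) (g • u)
      have c6 := T.comm (h • p) (g • x)
      have c7 := T.comm (h • x) z
      have c8 := T.comm (h • p) z
      have := T.side_const (u := g • u) (v := g • x) (p := h • x) (q := h • p) (z := z)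
        (by rw [T.comm, a.adj_smul_back]) (by omega) (by omega) (by omega)
      omega
  have hk0 : ∀ {s : G} {k : ℤ}, s ^ k ≠ 1 → k ≠ 0 := by
    rintro s k hk rfl
    simp at hk
  refine isFreeProductOfAtMostCyclics_of_pingPong g h (T.behind x p ∪ T.ahead h x p) x ?_ ?_ ?_ ?_
  · rintro (h' | h')
    exacts [b.self_notMem.1 h', b.self_notMem.2 h']
  · intro k hk
    exact hdisj _ (a.zpow_smul_mem a.self_notMem.1 a.self_notMem.2 (hk0 hk))
  · intro k hk z hz
    exact hdisj _ (a.zpow_smul_mem (fun h' => hdisj z (Or.inl h') hz)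
      (fun h' => hdisj z (Or.inr h') hz) (hk0 hk))
  · intro k hk z hz
    exact b.zpow_smul_mem (fun h' => hz (Or.inl h')) (fun h' => hz (Or.inr h')) (hk0 hk)

variable (T) in
/-- A measure for how far the forward axis of `g` at `x` is from the axis of `h`. -/
def spread (g h : G) (x : V) : ℕ := T.d (g • x) (h • x) + T.d (g • x) (h⁻¹ • x)

theorem spread_inv (g h : G) (x : V) : T.spread g h⁻¹ x = T.spread g h x := by
  simp only [spread, inv_inv]
  omega

theorem back_ne_back (r : T.IsReduced g h x)
    (hs : ∀ y, T.disp g h y = T.disp g h x → T.spread g h x ≤ T.spread g h y)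
    (a : T.Axial g x u v) (b : T.Axial h x p q) : u ≠ p := by
  rintro rfl
  obtain ⟨-, -, h1⟩ := d_smul_back_smul_back r a b
  have h2 := a.d_back_le
  have h3 := b.d_back_le
  have h4 : T.d (g • x) (h⁻¹ • x) = T.d (g • x) x + T.d x (h⁻¹ • x) :=
    T.concat a.adj_front b.adj_back a.front b.back a.ne.symm
  have h5 := T.tri (g • u) u (h⁻¹ • u)
  have h6 := T.d_inv_smul h x
  have h7 := T.d_inv_smul h u
  have h8 : T.disp g h x ≤ T.disp g h u := r g h u rfl
  have h9 := hs u (by simp only [disp] at h8 ⊢; omega)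
  have c1 := T.comm (g • x) x
  have c2 := T.comm (g • u) u
  simp only [spread] at h9
  omega

theorem isFreeProduct_of_reduced_moves (r : T.IsReduced g h x)
    (hs : ∀ y, T.disp g h y = T.disp g h x → T.spread g h x ≤ T.spread g h y)
    (hg : g • x ≠ x) (hh : h • x ≠ x) :
    IsFreeProductOfAtMostCyclics 2 (Subgroup.closure {g, h}) := by
  by_cases hfold : ∃ y, T.d x y = 1 ∧ T.d x (h • x) = T.d y (h • y) + 2
  · obtain ⟨y, hy1, hy2⟩ := hfold
    exact isFreeProduct_of_fold r hy1 hy2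
  by_cases hfold' : ∃ y, T.d x y = 1 ∧ T.d x (g • x) = T.d y (g • y) + 2
  · obtain ⟨y, hy1, hy2⟩ := hfold'
    rw [Set.pair_comm]
    exact isFreeProduct_of_fold r.symm hy1 hy2
  obtain ⟨p, q, b⟩ := exists_axial hh fun y hy1 hy2 => hfold ⟨y, hy1, hy2⟩
  obtain ⟨u, v, a⟩ := exists_axial hg fun y hy1 hy2 => hfold' ⟨y, hy1, hy2⟩
  have hup : u ≠ p := back_ne_back r hs a b
  have huq : u ≠ q := by
    refine back_ne_back r.inv_right (fun y hy => ?_) a b.inv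
    rw [spread_inv, spread_inv]
    exact hs y (by simpa only [disp, T.d_inv_smul] using hy)
  by_cases hvp : v = p
  · rw [Set.pair_comm, ← closure_pair_inv_left, Set.pair_comm]
    exact isFreeProduct_of_axial_axial r.inv_right a b.inv huq hup (hvp ▸ b.ne)
  · exact isFreeProduct_of_axial_axial r a b hup huq hvp

/-- If vertex stabilizers are 2-free products of cyclics, then so is the whole group. -/
theorem isFreeProductOfAtMostCyclics_closure_pair (T : TreeAction G V) [Nonempty V]
    (hstab : ∀ (g h : G) (x : V), g • x = x → h • x = x →
      IsFreeProductOfAtMostCyclics 2 (Subgroup.closure {g, h})) (g h : G) :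
    IsFreeProductOfAtMostCyclics 2 (Subgroup.closure {g, h}) := by
  let S := {t : G × G × V // Subgroup.closure {t.1, t.2.1} = Subgroup.closure {g, h}}
  let t₀ : S := ⟨⟨g, h, Classical.arbitrary V⟩, rfl⟩
  have : Nonempty S := ⟨t₀⟩
  obtain ⟨⟨⟨g', h', x₀⟩, hc⟩, hmin⟩ : ∃ t : S, ∀ t' : S,
      T.disp t.1.1 t.1.2.1 t.1.2.2 ≤ T.disp t'.1.1 t'.1.2.1 t'.1.2.2 :=
    ⟨Function.argmin (fun t : S => T.disp t.1.1 t.1.2.1 t.1.2.2),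
      fun t' => Function.argmin_le (fun t : S => T.disp t.1.1 t.1.2.1 t.1.2.2) t'⟩
  have r₀ : T.IsReduced g' h' x₀ := fun g'' h'' x'' hc' =>
    hmin ⟨⟨g'', h'', x''⟩, hc'.trans hc⟩
  let R := {y : V // T.disp g' h' y = T.disp g' h' x₀}
  have : Nonempty R := ⟨⟨x₀, rfl⟩⟩
  obtain ⟨⟨x, hx⟩, hspread⟩ : ∃ y : R, ∀ y' : R, T.spread g' h' y.1 ≤ T.spread g' h' y'.1 :=
    ⟨Function.argmin (fun y : R => T.spread g' h' y.1),
      fun y' => Function.argmin_le (fun y : R => T.spread g' h' y.1) y'⟩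
  have r : T.IsReduced g' h' x := r₀.of_le rfl hx.le
  change Subgroup.closure {g', h'} = _ at hc
  rw [← hc]
  by_cases hg : g' • x = x
  · by_cases hh : h' • x = x
    · exact hstab g' h' x hg hh
    · exact isFreeProduct_of_reduced_fix r hg hh
  · by_cases hh : h' • x = x
    · rw [Set.pair_comm]
      exact isFreeProduct_of_reduced_fix r.symm hh hg
    · exact isFreeProduct_of_reduced_moves r
        (fun y hy => hspread ⟨y, hy.trans hx⟩) hg hh

end TreeAction

namespace SimpleGraph

theorem dist_smul_le {G V : Type*} [Group G] [MulAction G V] {Γ : SimpleGraph V}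
    (hconn : Γ.Connected) (hadj : ∀ (g : G) x y, Γ.Adj x y → Γ.Adj (g • x) (g • y))
    (g : G) (x y : V) : Γ.dist (g • x) (g • y) ≤ Γ.dist x y := by
  obtain ⟨p, hp⟩ := hconn.exists_walk_length_eq_dist x y
  let f : Γ →g Γ := ⟨fun z => g • z, fun h => hadj g _ _ h⟩
  rw [← hp, ← p.length_map f]
  exact dist_le (p.map f)

/-- A group acting on a tree by automorphisms preserving a bipartition yields a `TreeAction`,
provided that only the identity fixes two distinct edges with a common endpoint. -/
noncomputable def IsTree.treeAction {G V : Type*} [Group G] [MulAction G V]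
    {Γ : SimpleGraph V} (hΓ : Γ.IsTree)
    (hadj : ∀ (g : G) x y, Γ.Adj x y → Γ.Adj (g • x) (g • y))
    (c : Γ.Coloring Bool) (hc : ∀ (g : G) x, c (g • x) = c x)
    (hfix : ∀ (g : G) x y z, Γ.Adj x y → Γ.Adj x z → y ≠ z →
      g • x = x → g • y = y → g • z = z → g = 1) : TreeAction G V where
  d := Γ.dist
  eq_zero _ _ := hΓ.connected.dist_eq_zero_iff
  comm _ _ := dist_comm
  tri _ _ _ := hΓ.connected.dist_triangle
  smul g x y := by
    refine le_antisymm (dist_smul_le hΓ.connected hadj g x y) ?_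
    simpa using dist_smul_le hΓ.connected hadj g⁻¹ (g • x) (g • y)
  exists_toward x z hxz := by
    obtain ⟨p, hp⟩ := hΓ.connected.exists_walk_length_eq_dist x z
    cases p with
    | nil => exact absurd rfl hxz
    | @cons _ u _ h p =>
      rw [Walk.length_cons] at hp
      have h1 : Γ.dist x u = 1 := dist_eq_one_iff_adj.2 h
      have h2 := dist_le p
      have h3 : Γ.dist x z ≤ Γ.dist x u + Γ.dist u z := hΓ.connected.dist_triangle
      exact ⟨u, h1, by omega⟩
  toward_unique x z u v hu hv huz hvz := by
    obtain ⟨p, hp⟩ := hΓ.connected.exists_walk_length_eq_dist u z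
    obtain ⟨q, hq⟩ := hΓ.connected.exists_walk_length_eq_dist v z
    rw [dist_eq_one_iff_adj] at hu hv
    have h1 : (Walk.cons hu p).IsPath :=
      Walk.isPath_of_length_eq_dist _ (by rw [Walk.length_cons, hp, huz])
    have h2 : (Walk.cons hv q).IsPath :=
      Walk.isPath_of_length_eq_dist _ (by rw [Walk.length_cons, hq, hvz])
    have h3 := congrArg Walk.snd ((hΓ.existsUnique_path x z).unique h1 h2)
    simpa using h3
  adj_ne x u z h := by
    rw [dist_eq_one_iff_adj] at h
    rw [dist_comm (u := u), dist_comm (u := x)]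
    exact (hΓ.dist_ne_of_adj z h).symm
  even g x := by
    obtain ⟨p, hp⟩ := hΓ.connected.exists_walk_length_eq_dist x (g • x)
    rw [← hp, c.even_length_iff_congr p, hc]
  fix_two_edges g x y z hy hz := by
    rw [dist_eq_one_iff_adj] at hy hz
    exact hfix g x y z hy hz

end SimpleGraph

namespace Monoid.PushoutI

variable {A : Type*} [Group A] {H : Bool → Type*} [∀ b, Group (H b)] {φ : ∀ b, A →* H b}

theorem base_mem_range_of (b : Bool) (a : A) :
    base φ a ∈ (of b : H b →* PushoutI φ).range :=
  ⟨φ b a, of_apply_eq_base φ b a⟩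

/-- The index of the first syllable of an element of an amalgamated product. -/
theorem exists_fstIdx (hinj : ∀ b, Function.Injective (φ b)) :
    ∃ f : PushoutI φ → Option Bool, f 1 = none ∧
      (∀ (i : Bool) (a : H i) (y : PushoutI φ), a ∉ (φ i).range → f y ≠ some i →
        f (of i a * y) = some i) ∧
      ∀ (b : Bool) (g : PushoutI φ) (h : H b), g ∉ (of b : H b →* PushoutI φ).range →
        f (g * of b h) = f g := by
  classical
  obtain ⟨d⟩ := NormalWord.transversal_nonempty φ hinj
  let f : PushoutI φ → Option Bool := fun g => (g • (NormalWord.empty : NormalWord d)).fstIdx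
  have hprod : ∀ w : NormalWord d, f w.prod = w.fstIdx := fun w => by
    simp only [f, NormalWord.prod_smul_empty]
  have hbase : ∀ (a : A) (y : PushoutI φ), f (base φ a * y) = f y := by
    intro a y
    simp only [f, mul_smul, NormalWord.base_smul_def]
  have hone : f 1 = none := by
    simp only [f, one_smul]
    rfl
  have hcons : ∀ (i : Bool) (a : H i) (y : PushoutI φ), a ∉ (φ i).range → f y ≠ some i →
      f (of i a * y) = some i := by
    intro i a y ha hy
    simp only [f, mul_smul]
    rw [← NormalWord.cons_eq_smul a _ hy ha]
    simp [NormalWord.cons, CoprodI.Word.fstIdx_cons]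
  have hof : ∀ (i b : Bool) (h : H b), i ≠ b → f (of b h) ≠ some i := by
    intro i b h hib
    by_cases hh : h ∈ (φ b).range
    · obtain ⟨a, rfl⟩ := hh
      rw [of_apply_eq_base, ← mul_one (base φ a), hbase, hone]
      simp
    · rw [← mul_one (of b h), hcons b h 1 hh (by simp [hone])]
      simpa using hib.symm
  refine ⟨f, hone, hcons, fun b g h hg => ?_⟩
  obtain ⟨w, rfl⟩ : ∃ w : NormalWord d, w.prod = g :=
    ⟨NormalWord.equiv g, NormalWord.equiv.left_inv g⟩
  induction w using NormalWord.consRecOn with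
  | empty => exact absurd (by simp) hg
  | cons i g w hmw _ hgr _ ih =>
    rw [NormalWord.prod_cons] at hg ⊢
    rw [mul_assoc, hcons i g w.prod hgr (by rwa [hprod])]
    refine hcons i g _ hgr ?_
    by_cases hw : w.prod ∈ (of b : H b →* PushoutI φ).range
    · obtain ⟨t, ht⟩ := hw
      rw [← ht, ← map_mul]
      refine hof i b _ ?_
      rintro rfl
      exact hg ⟨g * t, by rw [map_mul, ht]⟩
    · rwa [ih hw, hprod]
  | base a w _ ih =>
    rw [NormalWord.prod_smul] at hg ⊢
    rw [mul_assoc, hbase, hbase]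
    exact ih fun hw => hg (mul_mem (base_mem_range_of b a) hw)

variable (φ) in
/-- The vertices of the Bass-Serre tree of an amalgamated product are the left cosets of the two
factors. -/
abbrev BassSerreVertex : Type _ := Σ b : Bool, PushoutI φ ⧸ (of b : H b →* PushoutI φ).range

variable (φ) in
/-- The left coset of `g` modulo the factor `b`, as a vertex of the Bass-Serre tree. -/
def vertex (b : Bool) (g : PushoutI φ) : BassSerreVertex φ := ⟨b, (g : PushoutI φ ⧸ _)⟩

theorem vertex_eq_iff {b : Bool} {g k : PushoutI φ} :
    vertex φ b g = vertex φ b k ↔ g⁻¹ * k ∈ (of b : H b →* PushoutI φ).range := by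
  rw [← QuotientGroup.eq]
  simp [vertex]

theorem smul_vertex (b : Bool) (g k : PushoutI φ) : g • vertex φ b k = vertex φ b (g * k) := rfl

theorem exists_eq_vertex (x : BassSerreVertex φ) : ∃ g, x = vertex φ x.1 g := by
  obtain ⟨b, q⟩ := x
  obtain ⟨g, rfl⟩ := QuotientGroup.mk_surjective q
  exact ⟨g, rfl⟩

theorem smul_vertex_eq_self_iff {b : Bool} {g k : PushoutI φ} :
    g • vertex φ b k = vertex φ b k ↔ k⁻¹ * (g * k) ∈ (of b : H b →* PushoutI φ).range := by
  rw [eq_comm, smul_vertex, vertex_eq_iff]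

variable (φ) in
/-- The Bass-Serre tree of an amalgamated product of two groups. -/
def bassSerreGraph : SimpleGraph (BassSerreVertex φ) where
  Adj x y := ∃ b g, x = vertex φ b g ∧ y = vertex φ (!b) g
  symm := ⟨fun x y ⟨b, g, hx, hy⟩ => ⟨!b, g, hy, by rw [Bool.not_not, hx]⟩⟩
  loopless := ⟨fun x ⟨b, g, hx, hy⟩ => by
    have := congrArg Sigma.fst (hx.symm.trans hy)
    simp [vertex] at this⟩

theorem bassSerreGraph_adj_vertex (b : Bool) (g : PushoutI φ) :
    (bassSerreGraph φ).Adj (vertex φ b g) (vertex φ (!b) g) := ⟨b, g, rfl, rfl⟩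

theorem bassSerreGraph_adj_smul (g : PushoutI φ) (x y : BassSerreVertex φ)
    (h : (bassSerreGraph φ).Adj x y) : (bassSerreGraph φ).Adj (g • x) (g • y) := by
  obtain ⟨b, k, rfl, rfl⟩ := h
  exact bassSerreGraph_adj_vertex b (g * k)

variable (φ) in
/-- The bipartition of the Bass-Serre tree by the two kinds of cosets. -/
def bassSerreColoring : (bassSerreGraph φ).Coloring Bool :=
  SimpleGraph.Coloring.mk (fun x => x.1) (by
    rintro _ _ ⟨b, k, rfl, rfl⟩
    simp [vertex])

theorem bassSerreGraph_reachable_one (g : PushoutI φ) :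
    (bassSerreGraph φ).Reachable (vertex φ false 1) (vertex φ false g) := by
  have hof : ∀ (b : Bool) (h : H b), vertex φ b (of b h) = vertex φ b 1 := fun b h =>
    vertex_eq_iff.2 ⟨h⁻¹, by simp⟩
  induction g using PushoutI.induction_on with
  | of i h =>
    cases i with
    | false => rw [hof]
    | true =>
      have h1 := (bassSerreGraph_adj_vertex (φ := φ) false 1).reachable
      have h2 := (bassSerreGraph_adj_vertex (φ := φ) true (of true h)).reachable
      rw [hof] at h2
      exact h1.trans h2
  | base a => rw [← of_apply_eq_base φ false, hof]
  | mul g k hg hk =>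
    let f : bassSerreGraph φ →g bassSerreGraph φ :=
      ⟨fun z => g • z, fun h => bassSerreGraph_adj_smul g _ _ h⟩
    have h1 := hk.map f
    simp only [f, RelHom.coeFn_mk, smul_vertex, mul_one] at h1
    exact hg.trans h1

theorem bassSerreGraph_connected : (bassSerreGraph φ).Connected := by
  have h1 : ∀ x, (bassSerreGraph φ).Reachable (vertex φ false 1) x := by
    intro x
    obtain ⟨g, hg⟩ := exists_eq_vertex x
    rw [hg]
    cases x.1 with
    | false => exact bassSerreGraph_reachable_one g
    | true =>
      exact (bassSerreGraph_reachable_one g).trans (bassSerreGraph_adj_vertex false g).reachable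
  exact { preconnected := fun x y => (h1 x).symm.trans (h1 y), nonempty := ⟨vertex φ false 1⟩ }

/-- The two sides of the edge of the Bass-Serre tree given by the trivial coset. -/
theorem exists_side (hinj : ∀ b, Function.Injective (φ b)) :
    ∃ s : BassSerreVertex φ → Option Bool, (∀ b, s (vertex φ b 1) = some b) ∧
      ∀ b g, g ∉ (base φ).range → s (vertex φ b g) = s (vertex φ (!b) g) := by
  classical
  obtain ⟨f, hone, hcons, hmul⟩ := exists_fstIdx hinj
  let s : BassSerreVertex φ → Option Bool := fun x =>
    if x = vertex φ x.1 1 then some x.1 else f x.2.out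
  have hs1 : ∀ b g, g ∈ (of b : H b →* PushoutI φ).range → s (vertex φ b g) = some b := by
    intro b g hg
    have : vertex φ b g = vertex φ b 1 := vertex_eq_iff.2 (by simpa using hg)
    rw [this]
    exact if_pos rfl
  have hs2 : ∀ b g, g ∉ (of b : H b →* PushoutI φ).range → s (vertex φ b g) = f g := by
    intro b g hg
    have : vertex φ b g ≠ vertex φ b 1 := fun h => hg (by simpa using vertex_eq_iff.1 h)
    refine (if_neg this).trans ?_
    obtain ⟨⟨_, h, rfl⟩, hh⟩ :=
      QuotientGroup.mk_out_eq_mul (of b : H b →* PushoutI φ).range g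
    change f (g : PushoutI φ ⧸ (of b : H b →* PushoutI φ).range).out = _
    rw [hh, hmul b g h hg]
  have hs3 : ∀ b g, g ∉ (base φ).range → g ∈ (of b : H b →* PushoutI φ).range →
      s (vertex φ b g) = f g := by
    rintro b _ hg ⟨h, rfl⟩
    rw [hs1 b _ ⟨h, rfl⟩, ← mul_one (of b h), hcons b h 1 ?_ (by simp [hone])]
    rintro ⟨a, rfl⟩
    exact hg ⟨a, (of_apply_eq_base φ b a).symm⟩
  have hs : ∀ b g, g ∉ (base φ).range → s (vertex φ b g) = f g := fun b g hg => by
    by_cases h : g ∈ (of b : H b →* PushoutI φ).range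
    exacts [hs3 b g hg h, hs2 b g h]
  exact ⟨s, fun b => hs1 b 1 (one_mem _), fun b g hg => by rw [hs b g hg, hs _ g hg]⟩

theorem bassSerreGraph_isAcyclic (hinj : ∀ b, Function.Injective (φ b)) :
    (bassSerreGraph φ).IsAcyclic := by
  obtain ⟨s, hs1, hs2⟩ := exists_side hinj
  rw [SimpleGraph.isAcyclic_iff_forall_adj_isBridge]
  rintro _ _ ⟨b, g, rfl, rfl⟩
  rw [SimpleGraph.isBridge_iff]
  rintro ⟨p⟩
  have key : ∀ x y, ((bassSerreGraph φ).deleteEdges {s(vertex φ b g, vertex φ (!b) g)}).Walk x y →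
      s (g⁻¹ • x) = s (g⁻¹ • y) := by
    intro x y p
    induction p with
    | nil => rfl
    | cons h p ih =>
      rw [← ih]
      rw [SimpleGraph.deleteEdges_adj] at h
      obtain ⟨⟨c, k, rfl, rfl⟩, h⟩ := h
      refine hs2 c _ fun hk => h ?_
      obtain ⟨a, ha : base φ a = g⁻¹ * k⟩ := hk
      have hc : ∀ c, vertex φ c k = vertex φ c g := fun c =>
        (vertex_eq_iff.2 (ha ▸ base_mem_range_of c a)).symm
      rw [hc, hc, Set.mem_singleton_iff]
      cases b <;> cases c <;> simp [Sym2.eq_swap]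
  have h1 := key _ _ p
  rw [smul_vertex, smul_vertex, inv_mul_cancel, hs1, hs1] at h1
  simp at h1

theorem mem_base_range_of_smul_vertex (hinj : ∀ b, Function.Injective (φ b)) {b : Bool}
    {s g : PushoutI φ} (h1 : s • vertex φ b g = vertex φ b g)
    (h2 : s • vertex φ (!b) g = vertex φ (!b) g) : g⁻¹ * (s * g) ∈ (base φ).range := by
  rw [← inf_of_range_eq_base_range hinj (i := b) (j := !b) (by simp)]
  exact ⟨smul_vertex_eq_self_iff.1 h1, smul_vertex_eq_self_iff.1 h2⟩

theorem eq_one_of_smul_vertex (hinj : ∀ b, Function.Injective (φ b))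
    (hmal : Subgroup.IsMalnormal (base φ).range) (s : PushoutI φ) (x y z : BassSerreVertex φ)
    (hy : (bassSerreGraph φ).Adj x y) (hz : (bassSerreGraph φ).Adj x z) (hyz : y ≠ z)
    (sx : s • x = x) (sy : s • y = y) (sz : s • z = z) : s = 1 := by
  obtain ⟨b, g, rfl, rfl⟩ := hy
  obtain ⟨c, k, hx, rfl⟩ := hz
  obtain rfl : b = c := congrArg Sigma.fst hx
  have h1 := mem_base_range_of_smul_vertex hinj sx sy
  have h2 := mem_base_range_of_smul_vertex hinj (hx ▸ sx) sz
  have h3 : k⁻¹ * g ∉ (base φ).range := by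
    rintro ⟨a, ha⟩
    exact hyz (vertex_eq_iff.2 (ha ▸ base_mem_range_of (!b) a)).symm
  have h4 := hmal _ h3 _ h1 (by convert h2 using 1; group)
  simpa [inv_mul_eq_one] using h4

/-- The action of an amalgamated product with malnormal amalgamated subgroup on its Bass-Serre
tree. -/
noncomputable def bassSerreAction (hinj : ∀ b, Function.Injective (φ b))
    (hmal : Subgroup.IsMalnormal (base φ).range) : TreeAction (PushoutI φ) (BassSerreVertex φ) :=
  SimpleGraph.IsTree.treeAction (Γ := bassSerreGraph φ)
    ⟨bassSerreGraph_connected, bassSerreGraph_isAcyclic hinj⟩ bassSerreGraph_adj_smul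
    (bassSerreColoring φ) (fun _ _ => rfl) (eq_one_of_smul_vertex hinj hmal)

theorem isFreeProduct_of_smul_vertex (hinj : ∀ b, Function.Injective (φ b))
    (h2free : ∀ b, IsNFreeProductOfCyclics 2 (H b)) (g h : PushoutI φ) (x : BassSerreVertex φ)
    (hg : g • x = x) (hh : h • x = x) :
    IsFreeProductOfAtMostCyclics 2 (Subgroup.closure {g, h}) := by
  obtain ⟨c, hc⟩ := exists_eq_vertex x
  generalize x.1 = b at hc
  subst hc
  obtain ⟨u, hu⟩ := smul_vertex_eq_self_iff.1 hg
  obtain ⟨v, hv⟩ := smul_vertex_eq_self_iff.1 hh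
  let θ : H b →* PushoutI φ := (MulAut.conj c).toMonoidHom.comp (of b)
  have hθ : Function.Injective θ := (MulAut.conj c).injective.comp (of_injective hinj b)
  have hθu : θ u = g := by
    change c * of b u * c⁻¹ = g
    rw [hu]
    group
  have hθv : θ v = h := by
    change c * of b v * c⁻¹ = h
    rw [hv]
    group
  have hmap : (Subgroup.closure (Set.range ![u, v])).map θ = Subgroup.closure {g, h} := by
    rw [MonoidHom.map_closure, Matrix.range_cons_cons_empty, Set.image_pair, hθu, hθv]
  obtain ⟨k, m, hk, ⟨e⟩⟩ := h2free b ![u, v]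
  rw [← hmap]
  exact ⟨k, m, hk, ⟨((Subgroup.closure _).equivMapOfInjective θ hθ).symm.trans e⟩⟩

end Monoid.PushoutI

/-- **2-generated subgroups of cyclically amalgamated free products.**
Here `H true` plays the role of `H₁` and `H false` that of `H₂`, the amalgamated
free product `G = H₁ *_A H₂` is the pushout `Monoid.PushoutI φ` of the injective
maps `φ b : A →* H b` of the infinite cyclic group `A`, whose images are proper
subgroups, and whose common image in `G` is malnormal.  If `H₁` and `H₂` are
finitely generated of rank at least `2` and are 2-free products of cyclics,
then `G` is a 2-free product of cyclics. -/
theorem twoFreeProductOfCyclics_of_cyclicallyAmalgamated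
    (A : Type) [Group A] [IsCyclic A] [Infinite A]
    (H : Bool → Type) [∀ b, Group (H b)] [∀ b, Group.FG (H b)]
    (φ : ∀ b, A →* H b)
    (hinj : ∀ b, Function.Injective (φ b))
    (hproper : ∀ b, (φ b).range ≠ ⊤)
    (hrank : ∀ b, 2 ≤ Group.rank (H b))
    (hmal : Subgroup.IsMalnormal (Monoid.PushoutI.base φ).range)
    (h2free : ∀ b, IsNFreeProductOfCyclics 2 (H b)) :
    IsNFreeProductOfCyclics 2 (Monoid.PushoutI φ) := by
  intro x
  have hx : Set.range x = {x 0, x 1} := by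
    ext y
    simp [Fin.exists_fin_two, eq_comm]
  have : Nonempty (Monoid.PushoutI.BassSerreVertex φ) := ⟨Monoid.PushoutI.vertex φ false 1⟩
  rw [hx]
  exact (Monoid.PushoutI.bassSerreAction hinj hmal).isFreeProductOfAtMostCyclics_closure_pair
    (Monoid.PushoutI.isFreeProduct_of_smul_vertex hinj h2free) (x 0) (x 1)
end

section
/- Let H be a free group, let u, v ∈ H be nontrivial elements neither of which is a proper power in H, and assume u is not conjugate in H to v or to v⁻¹. Let G = ⟨H, t | tut⁻¹ = v⟩ be the HNN extension of H associated to the isomorphism of the infinite cyclic subgroups ⟨u⟩ ≅ ⟨v⟩ sending u to v. Then every subgroup of G generated by at most 2 elements is either abelian or a free group of rank two (isomorphic to the free group on two generators). -/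
/-- An element of a group is a proper power if it equals `y ^ k` for some
element `y` and some integer `k ≥ 2`. -/
def IsProperPower {G : Type*} [Group G] (x : G) : Prop :=
  ∃ (y : G) (k : ℕ), 2 ≤ k ∧ y ^ k = x

/-- Every nontrivial element of a free group acts nontrivially in some finite permutation
representation. -/
theorem FreeGroup.exists_lift_perm_ne_one {α : Type*} {w : FreeGroup α} (hw : w ≠ 1) :
    ∃ (B : Finset (FreeGroup α)) (σ : α → Equiv.Perm B), FreeGroup.lift σ w ≠ 1 := by
  classical
  let B : Finset (FreeGroup α) := (w.toWord.tails.map FreeGroup.mk).toFinset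
  have hB : ∀ l, l <:+ w.toWord → FreeGroup.mk l ∈ B := fun l hl => by
    simp only [B, List.mem_toFinset, List.mem_map, List.mem_tails]
    exact ⟨l, hl, rfl⟩
  have hext : ∀ i : α, ∃ σ : Equiv.Perm B, ∀ g : B, FreeGroup.of i * (g : FreeGroup α) ∈ B →
      ((σ g : B) : FreeGroup α) = FreeGroup.of i * g := fun i => by
    obtain ⟨σ, hσ⟩ := Set.MapsTo.exists_equiv_extend_of_card_eq (α := B) (t := B)
      (s := {g : B | FreeGroup.of i * (g : FreeGroup α) ∈ B}) (f := fun g => FreeGroup.of i * g)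
      (by simp)
      (fun g hg => hg) (fun g _ g' _ h => Subtype.ext (mul_left_cancel h))
    exact ⟨σ, fun g hg => hσ g hg⟩
  choose σ hσ using hext
  let b : B := ⟨1, hB [] List.nil_suffix⟩
  have key : ∀ l, l <:+ w.toWord →
      ((FreeGroup.lift σ (FreeGroup.mk l) b : B) : FreeGroup α) = FreeGroup.mk l := by
    intro l
    induction l with
    | nil =>
      intro _
      exact congrArg Subtype.val (DFunLike.congr_fun (_root_.map_one (FreeGroup.lift σ)) b)
    | cons x l ih =>
      intro hl
      have hl' : l <:+ w.toWord := (List.suffix_cons x l).trans hl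
      have e : FreeGroup.mk (x :: l) = FreeGroup.mk [x] * FreeGroup.mk l := by simp
      have ih' : FreeGroup.lift σ (FreeGroup.mk l) b = ⟨FreeGroup.mk l, hB l hl'⟩ :=
        Subtype.ext (ih hl')
      have hm := hB _ hl
      rw [e] at hm ⊢
      rw [_root_.map_mul, Equiv.Perm.mul_apply, ih']
      obtain ⟨i, ε⟩ := x
      cases ε with
      | true =>
        have := hσ i ⟨FreeGroup.mk l, hB l hl'⟩ hm
        have h1 : (FreeGroup.mk [(i, true)] : FreeGroup α) = FreeGroup.of i := rfl
        rw [h1, FreeGroup.lift_apply_of]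
        exact this
      | false =>
        have h1 : (FreeGroup.mk [(i, false)] : FreeGroup α) = (FreeGroup.of i)⁻¹ := rfl
        rw [h1] at hm ⊢
        rw [_root_.map_inv, FreeGroup.lift_apply_of]
        have h2 : σ i ⟨(FreeGroup.of i)⁻¹ * FreeGroup.mk l, hm⟩ = ⟨FreeGroup.mk l, hB l hl'⟩ := by
          apply Subtype.ext
          rw [hσ i _ (by simpa using hB l hl')]
          simp
        rw [← h2]
        exact congrArg Subtype.val ((σ i).symm_apply_apply _)
  refine ⟨B, σ, fun h => hw ?_⟩
  have := key w.toWord List.suffix_rfl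
  rw [FreeGroup.mk_toWord, h] at this
  exact this.symm

/-- If every pair of elements of every finite group is the image of `(g, h)` under a homomorphism,
then `g` and `h` satisfy no relation. -/
theorem FreeGroup.lift_pair_injective_of_forall_finite {K : Type*} [Group K] (g h : K)
    (H : ∀ (Q : Type) [Group Q] [Finite Q] (x y : Q), ∃ f : K →* Q, f g = x ∧ f h = y) :
    Function.Injective (FreeGroup.lift ![g, h]) := by
  rw [injective_iff_map_eq_one]
  intro w hw
  by_contra hne
  obtain ⟨B, σ, hσ⟩ := exists_lift_perm_ne_one hne
  obtain ⟨f, h0, h1⟩ := H (Equiv.Perm B) (σ 0) (σ 1)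
  have : f.comp (FreeGroup.lift ![g, h]) = FreeGroup.lift σ := by
    ext i; fin_cases i <;> simp [h0, h1]
  exact hσ (by rw [← this, MonoidHom.comp_apply, hw, _root_.map_one])

theorem FreeGroup.of_zpow_mul_of_ne {α : Type*} {i j : α} (hij : i ≠ j) {n : ℤ} (hn : n ≠ 0) :
    FreeGroup.of i ^ n * FreeGroup.of j ≠ FreeGroup.of j * FreeGroup.of i ^ n := by
  classical
  intro h
  have h1 := congrArg (FreeGroup.lift fun k =>
    if k = i then Equiv.addRight (1 : ℤ) else Equiv.swap 0 1) h
  simp only [_root_.map_mul, _root_.map_zpow, FreeGroup.lift_apply_of, if_true,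
    if_neg hij.symm] at h1
  have h2 := DFunLike.congr_fun h1 (0 : ℤ)
  have hz : ∀ (m : ℤ) (x : ℤ), (Equiv.addRight (1 : ℤ) ^ m : Equiv.Perm ℤ) x = x + m := by
    intro m
    induction m using Int.induction_on with
    | zero => simp
    | succ k ih => intro x; rw [zpow_add_one, Equiv.Perm.mul_apply, ih, Equiv.coe_addRight]; ring
    | pred k ih =>
      intro x
      rw [zpow_sub_one, Equiv.Perm.mul_apply, ih]
      change x + -1 + _ = _
      ring
  simp only [Equiv.Perm.mul_apply, Equiv.swap_apply_left, hz, Equiv.swap_apply_def] at h2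
  split_ifs at h2 <;> simp_all

/-- A homomorphism is determined by its values on a generating pair. -/
theorem MonoidHom.eval_pair_injective {K : Type*} [Group K] {g h : K}
    (hgen : Subgroup.closure {g, h} = ⊤) (Q : Type*) [Group Q] :
    Function.Injective fun f : K →* Q => (f g, f h) := by
  intro f f' hff
  simp only [Prod.mk.injEq] at hff
  refine MonoidHom.eq_of_eqOn_dense hgen ?_
  rintro x (rfl | rfl)
  exacts [hff.1, hff.2]

theorem FreeGroupBasis.isCyclic {K : Type*} [Group K] {ι : Type*} [Subsingleton ι]
    (b : FreeGroupBasis ι K) : IsCyclic K := by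
  have : IsCyclic (FreeGroup ι) := by
    rcases isEmpty_or_nonempty ι with hι | ⟨⟨i⟩⟩
    · infer_instance
    · have : Unique ι := ⟨⟨i⟩, fun j => Subsingleton.elim _ _⟩
      infer_instance
  exact b.repr.isCyclic.2 this

section IsFreeGroup

variable {F : Type} [Group F] [IsFreeGroup F]

/-- Noncommuting elements of a free group are a free basis of the subgroup they generate. -/
theorem IsFreeGroup.lift_pair_injective {g h : F} (hgh : g * h ≠ h * g) :
    Function.Injective (FreeGroup.lift ![g, h]) := by
  classical
  let K := Subgroup.closure {g, h}
  let g' : K := ⟨g, Subgroup.subset_closure (by simp)⟩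
  let h' : K := ⟨h, Subgroup.subset_closure (by simp)⟩
  have hgen : Subgroup.closure {g', h'} = ⊤ := by
    have := Subgroup.closure_closure_coe_preimage (k := {g, h})
    rw [← this]; congr 1
    ext x; simp [g', h', Subtype.ext_iff]
  let b := IsFreeGroup.basis K
  set ι := IsFreeGroup.Generators K
  have hfin : Finite ι := by
    have : Finite (K →* Multiplicative (ZMod 2)) :=
      Finite.of_injective _ (MonoidHom.eval_pair_injective hgen _)
    have : Finite (ι → Multiplicative (ZMod 2)) := Finite.of_equiv _ b.lift.symm
    by_contra hinf
    rw [not_finite_iff_infinite] at hinf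
    exact not_finite (ι → Multiplicative (ZMod 2))
  have hle : Nat.card ι ≤ 2 := by
    have h1 := Nat.card_le_card_of_injective _
      (MonoidHom.eval_pair_injective hgen (Multiplicative (ZMod 2)))
    rw [← Nat.card_congr b.lift, Nat.card_fun, Nat.card_prod] at h1
    have h2 : Nat.card (Multiplicative (ZMod 2)) = 2 := by simp
    rw [h2] at h1
    exact (Nat.pow_le_pow_iff_right (a := 2) (by norm_num)).1 (by simpa using h1)
  have hge : 2 ≤ Nat.card ι := by
    by_contra hlt
    have : Subsingleton ι := Finite.card_le_one_iff_subsingleton.1 (by omega)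
    have := b.isCyclic
    let := IsCyclic.commGroup (α := K)
    exact hgh (congrArg Subtype.val (mul_comm g' h'))
  have hinj : Function.Injective (FreeGroup.lift ![g', h']) := by
    apply FreeGroup.lift_pair_injective_of_forall_finite
    intro Q _ _ x y
    have hinj := MonoidHom.eval_pair_injective hgen Q
    have : Finite (K →* Q) := Finite.of_injective _ hinj
    have hbij := (Nat.bijective_iff_injective_and_card _).2 ⟨hinj, by
      rw [← Nat.card_congr b.lift, Nat.card_fun, Nat.card_prod, le_antisymm hle hge, sq]⟩
    obtain ⟨f, hf⟩ := hbij.2 (x, y)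
    exact ⟨f, congrArg Prod.fst hf, congrArg Prod.snd hf⟩
  have : FreeGroup.lift ![g, h] = K.subtype.comp (FreeGroup.lift ![g', h']) := by
    ext i; fin_cases i <;> simp [g', h']
  rw [this]
  exact K.subtype_injective.comp hinj

/-- Commuting elements of a free group are powers of a common element. -/
theorem IsFreeGroup.exists_zpow_eq_of_commute {g h : F} (hgh : g * h = h * g) :
    ∃ (z : F) (i j : ℤ), z ^ i = g ∧ z ^ j = h := by
  let K := Subgroup.closure {g, h}
  let b := IsFreeGroup.basis K
  have hcomm : ∀ x ∈ ({g, h} : Set F), ∀ y ∈ ({g, h} : Set F), x * y = y * x := by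
    rintro x (rfl | rfl) y (rfl | rfl) <;> simp [hgh]
  have := Subgroup.isMulCommutative_closure hcomm
  have : Subsingleton (IsFreeGroup.Generators K) := by
    refine ⟨fun i j => ?_⟩
    by_contra hij
    have h1 : b.repr (b i * b j) = b.repr (b j * b i) := congrArg _ (mul_comm' (b i) (b j))
    simp only [map_mul, FreeGroupBasis.repr_apply_coe] at h1
    exact FreeGroup.of_zpow_mul_of_ne hij one_ne_zero (by simpa using h1)
  have := b.isCyclic
  obtain ⟨z, hz⟩ := IsCyclic.exists_generator (α := K)
  obtain ⟨i, hi⟩ := hz ⟨g, Subgroup.subset_closure (by simp)⟩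
  obtain ⟨j, hj⟩ := hz ⟨h, Subgroup.subset_closure (by simp)⟩
  exact ⟨z, i, j, congrArg Subtype.val hi, congrArg Subtype.val hj⟩

theorem IsFreeGroup.commute_of_zpow_eq {g h : F} {m n : ℤ} (hm : m ≠ 0) (e : g ^ m = h ^ n) :
    g * h = h * g := by
  by_contra hgh
  have h1 : FreeGroup.of (0 : Fin 2) ^ m = FreeGroup.of 1 ^ n :=
    IsFreeGroup.lift_pair_injective hgh (by simpa using e)
  have h2 := congrArg (FreeGroup.lift ![Multiplicative.ofAdd (1 : ℤ), 1]) h1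
  simp only [map_zpow, FreeGroup.lift_apply_of] at h2
  simp [← ofAdd_zsmul, hm] at h2

theorem eq_one_or_neg_one_of_not_isProperPower {G : Type*} [Group G] {z : G} {j : ℤ}
    (hz : z ^ j ≠ 1) (hzp : ¬ IsProperPower (z ^ j)) : j = 1 ∨ j = -1 := by
  by_contra hj
  obtain ⟨k, rfl | rfl⟩ := j.eq_nat_or_neg
  · by_cases hk : 2 ≤ k
    · exact hzp ⟨z, k, hk, by simp⟩
    · obtain rfl : k = 0 := by omega
      simp at hz
  · by_cases hk : 2 ≤ k
    · exact hzp ⟨z⁻¹, k, hk, by simp⟩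
    · obtain rfl : k = 0 := by omega
      simp at hz

theorem IsFreeGroup.mem_zpowers_of_commute {w h : F} (hw : w ≠ 1) (hwp : ¬ IsProperPower w)
    (e : h * w = w * h) : h ∈ Subgroup.zpowers w := by
  obtain ⟨z, i, j, rfl, rfl⟩ := IsFreeGroup.exists_zpow_eq_of_commute e
  rcases eq_one_or_neg_one_of_not_isProperPower hw hwp with rfl | rfl
  · exact ⟨i, by simp⟩
  · exact ⟨-i, by simp⟩

theorem IsFreeGroup.mem_zpowers_of_zpow_mem {w h : F} (hw : w ≠ 1) (hwp : ¬ IsProperPower w)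
    {n : ℤ} (hn : n ≠ 0) (e : h ^ n ∈ Subgroup.zpowers w) : h ∈ Subgroup.zpowers w := by
  obtain ⟨m, hm⟩ := e
  exact mem_zpowers_of_commute hw hwp (commute_of_zpow_eq hn hm.symm)

/-- Maximal cyclic subgroups of a free group are malnormal. -/
theorem IsFreeGroup.mem_zpowers_of_conj_mem {w h g : F} (hw : w ≠ 1) (hwp : ¬ IsProperPower w)
    (hg : g ≠ 1) (hgw : g ∈ Subgroup.zpowers w) (e : h * g * h⁻¹ ∈ Subgroup.zpowers w) :
    h ∈ Subgroup.zpowers w := by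
  obtain ⟨m, rfl⟩ := hgw
  obtain ⟨n, hn⟩ := e
  have hm : m ≠ 0 := by rintro rfl; simp at hg
  refine mem_zpowers_of_commute hw hwp ?_
  by_contra hhw
  have hinj := IsFreeGroup.lift_pair_injective fun e => hhw e.symm
  have h1 : FreeGroup.of (0 : Fin 2) ^ n = FreeGroup.of 1 * FreeGroup.of 0 ^ m *
      (FreeGroup.of 1)⁻¹ := hinj (by simpa using hn)
  have h2 := congrArg (FreeGroup.lift ![Multiplicative.ofAdd (1 : ℤ), 1]) h1
  simp only [map_zpow, map_mul, map_inv, FreeGroup.lift_apply_of] at h2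
  simp only [Matrix.cons_val_zero, Matrix.cons_val_one, mul_one, one_mul, inv_one,
    ← ofAdd_zsmul, smul_eq_mul, Multiplicative.ofAdd.injective.eq_iff] at h2
  subst h2
  exact FreeGroup.of_zpow_mul_of_ne (zero_ne_one (α := Fin 2)) hm (eq_mul_inv_iff_mul_eq.1 h1)

/-- Nonconjugate maximal cyclic subgroups of a free group have no nontrivial conjugate elements. -/
theorem IsFreeGroup.eq_one_of_conj_mem {u v h g : F} (hu : u ≠ 1) (hv : v ≠ 1)
    (hup : ¬ IsProperPower u) (hvp : ¬ IsProperPower v) (huv : ¬ IsConj u v)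
    (huv' : ¬ IsConj u v⁻¹) (hgu : g ∈ Subgroup.zpowers u)
    (e : h * g * h⁻¹ ∈ Subgroup.zpowers v) : g = 1 := by
  by_contra hg
  obtain ⟨m, rfl⟩ := hgu
  have hm : m ≠ 0 := by rintro rfl; simp at hg
  have h1 : h * u * h⁻¹ ∈ Subgroup.zpowers v :=
    mem_zpowers_of_zpow_mem hv hvp hm (by rw [conj_zpow]; exact e)
  obtain ⟨i, hi⟩ := h1
  have h2 : u = (h⁻¹ * v * h) ^ i := by
    have : (h⁻¹ * v * h) ^ i = h⁻¹ * v ^ i * h := by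
      simpa using conj_zpow (a := h⁻¹) (b := v) (i := i)
    rw [this, show v ^ i = _ from hi]; group
  rcases eq_one_or_neg_one_of_not_isProperPower (h2 ▸ hu) (h2 ▸ hup) with rfl | rfl
  · exact huv (isConj_iff.2 ⟨h, by rw [h2]; group⟩)
  · exact huv' (isConj_iff.2 ⟨h, by rw [h2]; group⟩)

end IsFreeGroup

/-- The centralizer of a member of a free basis of rank two is generated by that member. -/
theorem FreeGroup.mem_zpowers_of_commute_of_lift_injective {K : Type*} [Group K] {g h x : K}
    (hinj : Function.Injective (FreeGroup.lift ![g, h])) (hx : x ∈ Subgroup.closure {g, h})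
    (hxg : x * g = g * x) : x ∈ Subgroup.zpowers g := by
  have hr : (FreeGroup.lift ![g, h]).range = Subgroup.closure {g, h} := by
    rw [FreeGroup.range_lift_eq_closure]; simp [Set.pair_comm]
  rw [← hr] at hx
  obtain ⟨w, rfl⟩ := hx
  have h1 : w * FreeGroup.of 0 = FreeGroup.of 0 * w := hinj (by simpa using hxg)
  have h0 : ¬ IsProperPower (FreeGroup.of (0 : Fin 2)) := by
    rintro ⟨y, k, hk, e⟩
    have h2 := congrArg (FreeGroup.lift fun _ => Multiplicative.ofAdd (1 : ℤ)) e
    rw [_root_.map_pow, FreeGroup.lift_apply_of] at h2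
    have h3 : (k : ℤ) * ((FreeGroup.lift fun _ => Multiplicative.ofAdd (1 : ℤ)) y).toAdd = 1 := by
      simpa using congrArg Multiplicative.toAdd h2
    have := Int.eq_one_or_neg_one_of_mul_eq_one h3
    omega
  obtain ⟨n, rfl⟩ := IsFreeGroup.mem_zpowers_of_commute (FreeGroup.of_ne_one 0) h0 h1
  exact ⟨n, by simp⟩

/-- The axioms of a distance function of a simplicial tree, restricted to a set of vertices which
may contain several copies of a vertex. -/
structure IsTreeDist {X : Type*} (d : X → X → ℤ) : Prop where
  self : ∀ x, d x x = 0
  symm : ∀ x y, d x y = d y x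
  nonneg : ∀ x y, 0 ≤ d x y
  parity : ∀ x y z, Even (d x y + d y z + d x z)
  four_point : ∀ p x y z, d x z + d p y ≤ max (d x y + d p z) (d y z + d p x)
  exists_step : ∀ x y, 0 < d x y → ∃ m, d x m = 1 ∧ d m y = d x y - 1

/-- The Gromov product of `x` and `y` based at `p`. -/
def gromovProd {X : Type*} (d : X → X → ℤ) (p x y : X) : ℤ := (d p x + d p y - d x y) / 2

namespace IsTreeDist

variable {X : Type*} {d : X → X → ℤ} (hd : IsTreeDist d)
include hd

theorem two_mul_gromovProd (p x y : X) :
    2 * gromovProd d p x y = d p x + d p y - d x y := by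
  obtain ⟨k, hk⟩ := hd.parity p x y
  unfold gromovProd
  omega

theorem triangle (x y z : X) : d x z ≤ d x y + d y z := by
  have := hd.four_point y x y z
  have := hd.self y
  have := hd.symm x y
  omega

theorem gromovProd_comm (p x y : X) : gromovProd d p x y = gromovProd d p y x := by
  unfold gromovProd
  rw [hd.symm x y, add_comm (d p x)]

theorem gromovProd_nonneg (p x y : X) : 0 ≤ gromovProd d p x y := by
  have := hd.two_mul_gromovProd p x y
  have := hd.triangle x p y
  have := hd.symm x p
  omega

theorem gromovProd_le_left (p x y : X) : gromovProd d p x y ≤ d p x := by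
  have := hd.two_mul_gromovProd p x y
  have := hd.triangle p x y
  omega

theorem gromovProd_le_right (p x y : X) : gromovProd d p x y ≤ d p y := by
  rw [hd.gromovProd_comm]; exact hd.gromovProd_le_left p y x

theorem gromovProd_self (p x : X) : gromovProd d p x x = d p x := by
  have := hd.two_mul_gromovProd p x x
  have := hd.self x
  omega

theorem min_gromovProd_le (p x y z : X) :
    min (gromovProd d p x y) (gromovProd d p y z) ≤ gromovProd d p x z := by
  have := hd.two_mul_gromovProd p x y
  have := hd.two_mul_gromovProd p y z
  have := hd.two_mul_gromovProd p x z
  have := hd.four_point p x y z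
  omega

theorem gromovProd_add_gromovProd (p q x : X) :
    gromovProd d p x q + gromovProd d q x p = d p q := by
  have := hd.two_mul_gromovProd p x q
  have := hd.two_mul_gromovProd q x p
  have := hd.symm x q
  have := hd.symm x p
  have := hd.symm p q
  omega

theorem exists_mem_segment (x y : X) (k : ℤ) (h0 : 0 ≤ k) (hk : k ≤ d x y) :
    ∃ m, d x m = k ∧ d m y = d x y - k := by
  obtain ⟨n, rfl⟩ := Int.eq_ofNat_of_zero_le h0
  clear h0
  induction n with
  | zero => exact ⟨x, by simpa using hd.self x, by simp⟩
  | succ n ih =>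
    push_cast at hk ⊢
    obtain ⟨m, h1, h2⟩ := ih (by omega)
    obtain ⟨m', h3, h4⟩ := hd.exists_step m y (by omega)
    have := hd.triangle x m m'
    have := hd.triangle x m' y
    exact ⟨m', by omega, by omega⟩

theorem gromovProd_eq_of_mem_segment {p x m : X} {k : ℤ} (h1 : d p m = k)
    (h2 : d m x = d p x - k) : gromovProd d p m x = k := by
  have := hd.two_mul_gromovProd p m x
  omega

theorem gromovProd_congr_left {p x x' : X} (h : d x x' = 0) (y : X) :
    gromovProd d p x y = gromovProd d p x' y := by
  have := hd.two_mul_gromovProd p x y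
  have := hd.two_mul_gromovProd p x' y
  have := hd.triangle p x x'
  have := hd.triangle p x' x
  have := hd.triangle x x' y
  have := hd.triangle x' x y
  have := hd.symm x x'
  omega

theorem gromovProd_congr_right {p x x' : X} (h : d x x' = 0) (y : X) :
    gromovProd d p y x = gromovProd d p y x' := by
  rw [hd.gromovProd_comm, hd.gromovProd_congr_left h, hd.gromovProd_comm]

theorem dist_congr_right {x x' : X} (h : d x x' = 0) (y : X) : d y x = d y x' := by
  have := hd.triangle y x x'
  have := hd.triangle y x' x
  have := hd.symm x x'
  omega

end IsTreeDist

/-- An action by isometries on a tree, without inversions. -/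
structure IsTreeAction (G : Type*) {X : Type*} [Group G] [MulAction G X] (d : X → X → ℤ) : Prop
    extends IsTreeDist d where
  dist_smul : ∀ (g : G) x y, d (g • x) (g • y) = d x y
  not_inversion : ∀ (g : G) x, d x (g • x) = 1 → d x (g • g • x) ≠ 0

namespace IsTreeAction

variable {G X : Type*} [Group G] [MulAction G X] {d : X → X → ℤ} (hd : IsTreeAction G d)
include hd

theorem dist_smul_left (g : G) (x y : X) : d (g • x) y = d x (g⁻¹ • y) := by
  rw [← hd.dist_smul g x, smul_inv_smul]

theorem dist_inv_smul (g : G) (x : X) : d x (g⁻¹ • x) = d x (g • x) := by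
  rw [← hd.dist_smul_left, hd.symm]

theorem gromovProd_smul_add (s : G) (p x : X) :
    gromovProd d p (s • x) (s • p) + gromovProd d p x (s⁻¹ • p) = d p (s • p) := by
  have := hd.two_mul_gromovProd p (s • x) (s • p)
  have := hd.two_mul_gromovProd p x (s⁻¹ • p)
  have := hd.dist_smul s x p
  have := hd.dist_smul_left s x p
  have := hd.symm p (s • x)
  have := hd.symm p x
  have := hd.dist_inv_smul s p
  omega

/-- The stabilizer of a vertex. -/
def stab (p : X) : Subgroup G where
  carrier := {g | d p (g • p) = 0}
  one_mem' := by simpa using hd.self p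
  inv_mem' := by
    intro g hg
    simpa [hd.dist_inv_smul] using hg
  mul_mem' := by
    intro g h hg hh
    rw [Set.mem_ofPred_eq] at *
    have := hd.triangle p (g • p) (g • h • p)
    have := hd.dist_smul g p (h • p)
    have := hd.nonneg p (g • h • p)
    rw [mul_smul]
    omega

theorem dist_zpow_smul {a : G} {p : X} (h : d p (a • p) = 0) (n : ℤ) : d p (a ^ n • p) = 0 :=
  (hd.stab p).zpow_mem h n

theorem gromovProd_smul_of_fix {g : G} {p : X} (h : d p (g • p) = 0) (x y : X) :
    gromovProd d p (g • x) (g • y) = gromovProd d p x y := by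
  have := hd.two_mul_gromovProd p (g • x) (g • y)
  have := hd.two_mul_gromovProd p x y
  have := hd.dist_smul g x y
  have := hd.dist_smul g p x
  have := hd.dist_smul g p y
  have := hd.dist_congr_right h (g • x)
  have := hd.dist_congr_right h (g • y)
  have := hd.symm (g • x) p
  have := hd.symm (g • y) p
  have := hd.symm (g • x) (g • p)
  have := hd.symm (g • y) (g • p)
  omega

/-- If `g` fixes `p` and the segments from `p` to `q` and to `g • q` have a common part of length at
least `k`, then `g` fixes the points at distance at most `k` of this common part. -/
theorem dist_smul_eq_zero {g : G} {p q m : X} {k : ℤ} (h : d p (g • p) = 0) (h1 : d p m = k)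
    (h2 : d m q = d p q - k) (h3 : k ≤ gromovProd d p (g • q) q) : d m (g • m) = 0 := by
  have e := hd.gromovProd_eq_of_mem_segment h1 h2
  have := hd.gromovProd_smul_of_fix h m q
  have := hd.min_gromovProd_le p (g • m) (g • q) q
  have := hd.min_gromovProd_le p (g • m) q m
  have := hd.gromovProd_comm p m q
  have := hd.two_mul_gromovProd p (g • m) m
  have := hd.dist_smul g p m
  have := hd.dist_congr_right h (g • m)
  have := hd.symm (g • m) p
  have := hd.symm (g • m) m
  have := hd.symm (g • m) (g • p)
  have := hd.nonneg m (g • m)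
  omega

/-- If the segments from `p` to `s • p` and to `s⁻¹ • p` agree on at least half of their length,
then `s` fixes a point. -/
theorem exists_fix {s : G} {p : X}
    (h : d p (s • p) ≤ 2 * gromovProd d p (s • p) (s⁻¹ • p)) : ∃ m, d m (s • m) = 0 := by
  have hL := hd.nonneg p (s • p)
  have hm : ∀ k l, 0 ≤ k → 0 ≤ l → k + l = d p (s • p) → ∃ m, d p m = k ∧ d p (s⁻¹ • m) = l ∧
      gromovProd d p m (s • p) = k ∧ gromovProd d p (s⁻¹ • m) (s⁻¹ • p) = l := by
    intro k l hk hl hkl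
    obtain ⟨m, h1, h2⟩ := hd.exists_mem_segment p (s • p) k hk (by omega)
    have h3 : d p (s⁻¹ • m) = l := by rw [← hd.dist_smul_left, hd.symm]; omega
    refine ⟨m, h1, h3, hd.gromovProd_eq_of_mem_segment h1 h2,
      hd.gromovProd_eq_of_mem_segment h3 ?_⟩
    rw [hd.dist_smul, hd.symm, hd.dist_inv_smul]; omega
  have hmm : ∀ {m n k l}, gromovProd d p m (s • p) = k → gromovProd d p (s⁻¹ • n) (s⁻¹ • p) = l →
      k ≤ gromovProd d p (s • p) (s⁻¹ • p) → d p m = k → d p (s⁻¹ • n) = l →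
      d m (s⁻¹ • n) ≤ k + l - 2 * min k l := by
    intro m n k l h1 h2 h3 h4 h5
    have := hd.min_gromovProd_le p m (s • p) (s⁻¹ • p)
    have := hd.min_gromovProd_le p m (s⁻¹ • p) (s⁻¹ • n)
    have := hd.gromovProd_comm p (s⁻¹ • p) (s⁻¹ • n)
    have := hd.two_mul_gromovProd p m (s⁻¹ • n)
    omega
  obtain ⟨k, hk | hk⟩ := (d p (s • p)).even_or_odd'
  · obtain ⟨m, h1, h2, h3, h4⟩ := hm k k (by omega) (by omega) (by omega)
    refine ⟨m, ?_⟩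
    have := hmm h3 h4 (by omega) h1 h2
    have := hd.nonneg m (s⁻¹ • m)
    rw [← hd.dist_inv_smul]
    omega
  · exfalso
    obtain ⟨m, h1, h2, h3, h4⟩ := hm (k + 1) k (by omega) (by omega) (by omega)
    obtain ⟨n, h5, h6, h7, h8⟩ := hm k (k + 1) (by omega) (by omega) (by omega)
    have e1 := hmm h3 h4 (by omega) h1 h2
    have e2 := hmm h3 h8 (by omega) h1 h6
    have e3 := hmm h7 h4 (by omega) h5 h2
    have e4 := hd.dist_inv_smul s m
    have e5 : d m (s • m) = 1 := by
      obtain ⟨i, hi⟩ := hd.parity p m (s⁻¹ • m)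
      have := hd.nonneg m (s⁻¹ • m)
      omega
    refine hd.not_inversion s m e5 ?_
    have := hd.triangle m (s • n) (s • s • m)
    have := hd.dist_smul s n (s • m)
    have := hd.dist_smul_left s n m
    have := hd.dist_smul_left s m n
    have := hd.symm m (s • n)
    have := hd.symm n (s • m)
    have := hd.nonneg m (s • s • m)
    omega

end IsTreeAction

/-- The ping-pong lemma for a pair of cyclic groups. -/
theorem FreeGroup.lift_pair_injective_of_ping_pong {G X : Type*} [Group G] [MulAction G X] {a b : G}
    {A B : Set X} (hA : A.Nonempty) (hB : B.Nonempty) (hAB : Disjoint A B)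
    (ha : ∀ n : ℤ, n ≠ 0 → ∀ x ∈ B, a ^ n • x ∈ A)
    (hb : ∀ n : ℤ, n ≠ 0 → ∀ x ∈ A, b ^ n • x ∈ B) :
    Function.Injective (FreeGroup.lift ![a, b]) := by
  have h0 : FreeGroup.lift ![a, b] =
      (Monoid.CoprodI.lift fun i => FreeGroup.lift fun _ : Unit => ![a, b] i).comp
        (freeGroupEquivCoprodI (ι := Fin 2)).toMonoidHom := by
    ext i
    simp
  rw [h0, MonoidHom.coe_comp]
  refine Function.Injective.comp ?_ (MulEquiv.injective freeGroupEquivCoprodI)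
  have hz : ∀ h : FreeGroup Unit, h ≠ 1 → ∃ n : ℤ, n ≠ 0 ∧ h = FreeGroup.of () ^ n := by
    intro h hh
    obtain ⟨n, rfl⟩ := FreeGroup.freeGroupUnitEquivInt.symm.surjective h
    exact ⟨n, by rintro rfl; exact hh rfl, rfl⟩
  refine Monoid.CoprodI.lift_injective_of_ping_pong
    (fun i => FreeGroup.lift fun _ : Unit => ![a, b] i) (Or.inr ⟨0, ?_⟩) ![A, B] ?_ ?_ ?_
  · have : Infinite (FreeGroup Unit) := Infinite.of_injective _
      FreeGroup.freeGroupUnitEquivInt.symm.injective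
    exact (Cardinal.natCast_lt_aleph0 (n := 3)).le.trans (Cardinal.aleph0_le_mk _)
  · simp [Fin.forall_fin_two, hA, hB]
  · intro i j hij
    fin_cases i <;> fin_cases j <;> simp_all [Function.onFun, hAB.symm]
  · intro i j hij h hh
    obtain ⟨n, hn, rfl⟩ := hz h hh
    rw [_root_.map_zpow, FreeGroup.lift_apply_of]
    rintro _ ⟨x, hx, rfl⟩
    fin_cases i <;> fin_cases j <;> simp_all

namespace Subgroup

variable {G : Type*} [Group G]

theorem closure_pair_eq {a b c : G} (h1 : c ∈ closure {a, b}) (h2 : b ∈ closure {a, c}) :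
    closure {a, c} = closure {a, b} := by
  apply le_antisymm <;> rw [closure_le] <;> rintro x (rfl | rfl)
  exacts [subset_closure (by simp), h1, subset_closure (by simp), h2]

theorem left_mem_closure_pair (a b : G) : a ∈ closure {a, b} := subset_closure (by simp)

theorem right_mem_closure_pair (a b : G) : b ∈ closure {a, b} := subset_closure (by simp)

theorem closure_pair_mul_zpow (a b : G) (n : ℤ) : closure {a, b * a ^ n} = closure {a, b} := by
  have ha := fun c => left_mem_closure_pair a c
  refine closure_pair_eq
    (mul_mem (right_mem_closure_pair _ _) (zpow_mem (ha _) n)) ?_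
  have := mul_mem (right_mem_closure_pair a (b * a ^ n)) (zpow_mem (ha (b * a ^ n)) (-n))
  simpa using this

theorem closure_pair_inv_mul (a b : G) : closure {a, a⁻¹ * b} = closure {a, b} := by
  have ha := fun c => left_mem_closure_pair a c
  refine closure_pair_eq (mul_mem (inv_mem (ha _)) (right_mem_closure_pair _ _)) ?_
  have := mul_mem (ha (a⁻¹ * b)) (right_mem_closure_pair a (a⁻¹ * b))
  simpa using this

theorem closure_pair_inv (a b : G) : closure {a, b⁻¹} = closure {a, b} := by
  refine closure_pair_eq (inv_mem (right_mem_closure_pair _ _)) ?_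
  simpa using inv_mem (right_mem_closure_pair a b⁻¹)

theorem closure_pair_comm (a b : G) : closure {a, b} = closure {b, a} := by
  rw [Set.pair_comm]

/-- The subgroup is abelian or free of rank two. -/
def IsCommOrFreePair (S : Subgroup G) : Prop :=
  (∀ a b : S, a * b = b * a) ∨ Nonempty (S ≃* FreeGroup (Fin 2))

theorem isCommOrFreePair_of_commute {S : Subgroup G} {a b : G} (hS : closure {a, b} = S)
    (h : a * b = b * a) : IsCommOrFreePair S := by
  subst hS
  left
  have hcomm : ∀ x ∈ ({a, b} : Set G), ∀ y ∈ ({a, b} : Set G), x * y = y * x := by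
    rintro x (rfl | rfl) y (rfl | rfl) <;> simp [h]
  have := Subgroup.isMulCommutative_closure hcomm
  exact fun x y => mul_comm' x y

theorem isCommOrFreePair_of_injective {S : Subgroup G} {a b : G} (hS : closure {a, b} = S)
    (h : Function.Injective (FreeGroup.lift ![a, b])) : IsCommOrFreePair S := by
  subst hS
  right
  have hr : (FreeGroup.lift ![a, b]).range = closure {a, b} := by
    rw [FreeGroup.range_lift_eq_closure]; simp [Set.pair_comm]
  exact ⟨((MonoidHom.ofInjective h).trans (MulEquiv.subgroupCongr hr)).symm⟩

end Subgroup

/-- An action on a tree with free vertex groups and isolated, commutative edge groups, such that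
nontrivial elements fix at most one edge. -/
structure IsPinchedAction (G : Type*) {X : Type*} [Group G] [MulAction G X] (d : X → X → ℤ) : Prop
    extends IsTreeAction G d where
  eq_one_of_fix : ∀ (g : G) x y, d x (g • x) = 0 → d y (g • y) = 0 → 2 ≤ d x y → g = 1
  fix_of_zpow_fix : ∀ (g : G) x y (n : ℤ), d x y = 1 → d x (g • x) = 0 → n ≠ 0 →
    d y (g ^ n • y) = 0 → d y (g • y) = 0
  commute_of_fix : ∀ (g h : G) x y, d x y = 1 → d x (g • x) = 0 → d y (g • y) = 0 →
    d x (h • x) = 0 → d y (h • y) = 0 → g * h = h * g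
  injective_of_fix : ∀ (g h : G) x, d x (g • x) = 0 → d x (h • x) = 0 → g * h ≠ h * g →
    Function.Injective (FreeGroup.lift ![g, h])

namespace IsPinchedAction

open Subgroup

variable {G X : Type*} [Group G] [MulAction G X] {d : X → X → ℤ} (hd : IsPinchedAction G d)
include hd

theorem fix_segment {a : G} {p q m : X} {n : ℤ} (hn : n ≠ 0) (ha : d p (a • p) = 0)
    (h1 : d p m = 1) (h2 : d m q = d p q - 1) (h3 : 1 ≤ gromovProd d p (a ^ n • q) q) :
    d m (a • m) = 0 :=
  hd.fix_of_zpow_fix a p m n h1 ha hn (hd.dist_smul_eq_zero (hd.dist_zpow_smul ha n) h1 h2 h3)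

theorem gromovProd_zpow_smul_le_one {a : G} {p q : X} {n : ℤ} (hn : n ≠ 0)
    (ha : d p (a • p) = 0) (ha1 : a ≠ 1) : gromovProd d p (a ^ n • q) q ≤ 1 := by
  by_contra! h
  have := hd.gromovProd_le_right p (a ^ n • q) q
  obtain ⟨m, h1, h2⟩ := hd.exists_mem_segment p q 2 (by omega) (by omega)
  obtain ⟨m', h3, h4⟩ := hd.exists_mem_segment p m 1 (by omega) (by omega)
  have h6 := hd.triangle m' m q
  have h7 := hd.triangle p m' q
  have h5 := hd.fix_segment hn ha h3 (by omega) (by omega : 1 ≤ gromovProd d p (a ^ n • q) q)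
  exact ha1 (hd.eq_one_of_fix a p m ha (hd.fix_of_zpow_fix a m' m n (by omega) h5 hn
    (hd.dist_smul_eq_zero (hd.dist_zpow_smul ha n) h1 h2 (by omega))) (by omega))

/-- Pairs of elements which both have a fixed point. -/
theorem isCommOrFreePair_of_fix_of_fix {S : Subgroup G} {a b : G} {p q : X}
    (hS : closure {a, b} = S) (ha : d p (a • p) = 0) (hb : d q (b • q) = 0) :
    IsCommOrFreePair S := by
  obtain ⟨D, hD⟩ := Int.eq_ofNat_of_zero_le (hd.nonneg p q)
  induction D using Nat.strong_induction_on generalizing p q with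
  | _ D ih =>
  rcases Nat.eq_zero_or_pos D with rfl | hpos
  · have hb' : d p (b • p) = 0 := by
      have := hd.triangle p q (b • q)
      have := hd.triangle p (b • q) (b • p)
      have := hd.dist_smul b q p
      have := hd.symm p q
      have := hd.nonneg p (b • p)
      omega
    by_cases h : a * b = b * a
    · exact isCommOrFreePair_of_commute hS h
    · exact isCommOrFreePair_of_injective hS (hd.injective_of_fix a b p ha hb' h)
  · obtain ⟨m, h1, h2⟩ := hd.exists_mem_segment p q 1 (by omega) (by omega)
    obtain ⟨m', h3, h4⟩ := hd.exists_mem_segment q p 1 (by omega) (by rw [hd.symm]; omega)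
    by_cases hm : d m (a • m) = 0
    · exact ih (D - 1) (by omega) hm hb (by omega)
    by_cases hm' : d m' (b • m') = 0
    · exact ih (D - 1) (by omega) ha hm' (by rw [hd.symm, h4, hd.symm]; omega)
    refine isCommOrFreePair_of_injective hS ?_
    have ea : ∀ n : ℤ, n ≠ 0 → gromovProd d p (a ^ n • q) q ≤ 0 := fun n hn => by
      by_contra! h
      exact hm (hd.fix_segment hn ha h1 h2 h)
    have eb : ∀ n : ℤ, n ≠ 0 → gromovProd d q (b ^ n • p) p ≤ 0 := fun n hn => by
      by_contra! h
      exact hm' (hd.fix_segment hn hb h3 h4 h)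
    have hp : gromovProd d p p q = 0 := by
      have := hd.gromovProd_nonneg p p q
      have := hd.gromovProd_le_left p p q
      have := hd.self p
      omega
    have hq : gromovProd d p q q = D := by rw [hd.gromovProd_self]; exact hD
    refine FreeGroup.lift_pair_injective_of_ping_pong (X := X)
      (A := {x | gromovProd d p x q ≤ 0}) (B := {x | 0 < gromovProd d p x q})
      ⟨p, hp.le⟩ ⟨q, show 0 < gromovProd d p q q by omega⟩ ?_ ?_ ?_
    · rw [Set.disjoint_left]
      intro x hx hx'
      simp only [Set.mem_ofPred_eq] at hx hx'
      omega
    · intro n hn x hx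
      simp only [Set.mem_ofPred_eq] at hx ⊢
      have := ea n hn
      have := hd.gromovProd_smul_of_fix (hd.dist_zpow_smul ha n) x q
      have := hd.min_gromovProd_le p (a ^ n • q) (a ^ n • x) q
      have := hd.gromovProd_comm p (a ^ n • q) (a ^ n • x)
      omega
    · intro n hn x hx
      simp only [Set.mem_ofPred_eq] at hx ⊢
      have := eb n hn
      have := hd.gromovProd_smul_of_fix (hd.dist_zpow_smul hb n) x p
      have := hd.min_gromovProd_le q (b ^ n • p) (b ^ n • x) p
      have := hd.gromovProd_comm q (b ^ n • p) (b ^ n • x)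
      have := hd.gromovProd_add_gromovProd p q x
      have := hd.gromovProd_add_gromovProd p q (b ^ n • x)
      omega

/-- Ping-pong for an element `a` with a fixed point and a translation `b`. -/
theorem injective_of_gromovProd_le {a b : G} {p : X} {κ μ : ℤ} (ha : d p (a • p) = 0)
    (hκ : 0 ≤ κ) (hμ : 0 ≤ μ) (hN : κ + μ < d p (b • p))
    (h1 : ∀ n : ℤ, n ≠ 0 → gromovProd d p (a ^ n • b • p) (b • p) ≤ κ)
    (h2 : ∀ n : ℤ, n ≠ 0 → gromovProd d p (a ^ n • b⁻¹ • p) (b⁻¹ • p) ≤ μ)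
    (h3 : ∀ n : ℤ, gromovProd d p (a ^ n • b⁻¹ • p) (b • p) ≤ min κ μ) :
    Function.Injective (FreeGroup.lift ![a, b]) := by
  have hp : ∀ x, gromovProd d p p x = 0 := fun x => by
    have := hd.gromovProd_nonneg p p x
    have := hd.gromovProd_le_left p p x
    have := hd.self p
    omega
  have h30 := h3 0
  rw [zpow_zero, one_smul] at h30
  have hpos : ∀ n : ℕ, ∀ x, gromovProd d p x (b⁻¹ • p) ≤ μ →
      κ < gromovProd d p (b ^ (n + 1) • x) (b • p) := by
    intro n
    induction n with
    | zero =>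
      intro x hx
      have := hd.gromovProd_smul_add b p x
      rw [zero_add, pow_one]
      omega
    | succ n ih =>
      intro x hx
      rw [pow_succ, mul_smul]
      refine ih _ ?_
      have := hd.gromovProd_smul_add b p x
      have := hd.min_gromovProd_le p (b⁻¹ • p) (b • x) (b • p)
      have := hd.gromovProd_comm p (b⁻¹ • p) (b • x)
      omega
  have hneg : ∀ n : ℕ, ∀ x, gromovProd d p x (b • p) ≤ κ →
      μ < gromovProd d p (b⁻¹ ^ (n + 1) • x) (b⁻¹ • p) := by
    intro n
    induction n with
    | zero =>
      intro x hx
      have := hd.gromovProd_smul_add b⁻¹ p x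
      have := hd.dist_inv_smul b p
      rw [zero_add, pow_one]
      rw [inv_inv] at *
      omega
    | succ n ih =>
      intro x hx
      rw [pow_succ, mul_smul]
      refine ih _ ?_
      have := hd.gromovProd_smul_add b⁻¹ p x
      have := hd.dist_inv_smul b p
      have := hd.min_gromovProd_le p (b⁻¹ • p) (b⁻¹ • x) (b • p)
      have := hd.gromovProd_comm p (b⁻¹ • p) (b⁻¹ • x)
      rw [inv_inv] at *
      omega
  refine FreeGroup.lift_pair_injective_of_ping_pong (X := X)
    (A := {x | gromovProd d p x (b • p) ≤ κ ∧ gromovProd d p x (b⁻¹ • p) ≤ μ})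
    (B := {x | κ < gromovProd d p x (b • p) ∨ μ < gromovProd d p x (b⁻¹ • p)})
    ⟨p, by simp [hp, hκ, hμ]⟩ ⟨b • p, Or.inl ?_⟩ ?_ ?_ ?_
  · rw [hd.gromovProd_self]
    omega
  · rw [Set.disjoint_left]
    rintro x ⟨hx, hx'⟩ (h | h)
    all_goals omega
  · intro n hn x hx
    have fix := fun k => hd.gromovProd_smul_of_fix (hd.dist_zpow_smul ha k)
    have e1 := fix n x (b • p)
    have e2 := fix n x (b⁻¹ • p)
    have e3 := fix (-n) (a ^ n • b • p) (b⁻¹ • p)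
    rw [smul_smul _ (a ^ n), ← zpow_add, neg_add_cancel, zpow_zero, one_smul] at e3
    have := h1 n hn
    have := h2 n hn
    have := h3 n
    have := h3 (-n)
    have := hd.min_gromovProd_le p (a ^ n • b • p) (a ^ n • x) (b • p)
    have := hd.min_gromovProd_le p (a ^ n • b • p) (a ^ n • x) (b⁻¹ • p)
    have := hd.min_gromovProd_le p (a ^ n • b⁻¹ • p) (a ^ n • x) (b • p)
    have := hd.min_gromovProd_le p (a ^ n • b⁻¹ • p) (a ^ n • x) (b⁻¹ • p)
    have := hd.gromovProd_comm p (a ^ n • x) (a ^ n • b • p)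
    have := hd.gromovProd_comm p (a ^ n • x) (a ^ n • b⁻¹ • p)
    have := hd.gromovProd_comm p (a ^ (-n) • b⁻¹ • p) (b • p)
    simp only [Set.mem_ofPred_eq] at hx ⊢
    omega
  · rintro n hn x ⟨hx1, hx2⟩
    obtain ⟨k, rfl | rfl⟩ := n.eq_nat_or_neg
    · obtain ⟨k, rfl⟩ := Nat.exists_eq_succ_of_ne_zero (n := k) (by rintro rfl; simp at hn)
      refine Or.inl ?_
      rw [zpow_natCast]
      exact hpos k x hx2
    · obtain ⟨k, rfl⟩ := Nat.exists_eq_succ_of_ne_zero (n := k) (by rintro rfl; simp at hn)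
      refine Or.inr ?_
      rw [zpow_neg, ← inv_zpow, zpow_natCast]
      exact hneg k x hx1

end IsPinchedAction

/-- Products `k₁ yᵉ¹ k₂ yᵉ² ⋯` with factors `kᵢ` in `K`, whose images under `f` do not backtrack. -/
inductive IsReducedProd {F G X : Type*} [Group F] [Group G] [MulAction G X] (d : X → X → ℤ) (p : X)
    (f : F →* G) (K : Subgroup F) (y : F) : F → Prop
  | base (k : F) (hk : k ∈ K) : IsReducedProd d p f K y k
  | step (k : F) (hk : k ∈ K) (ε : ℤˣ) (w : F) (hw : IsReducedProd d p f K y w)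
      (h : gromovProd d p (f w • p) ((f y ^ (ε : ℤ))⁻¹ • p) ≤ 0) :
      IsReducedProd d p f K y (k * y ^ (ε : ℤ) * w)

/-- A Britton-type lemma: a homomorphism which is injective on `K` is injective on a group generated
by `K` and `y`, if `K` fixes `p` and only elements of edge groups fix the edges from `p` to its
translates by `y` and `y⁻¹`. -/
theorem IsTreeAction.injective_of_forall_fix {F G X : Type*} [Group F] [Group G] [MulAction G X]
    {d : X → X → ℤ} (hd : IsTreeAction G d) {p : X} {f : F →* G} {K : Subgroup F} {y : F}
    (hKp : ∀ k ∈ K, d p (f k • p) = 0) (hy : d p (f y • p) = 1)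
    (hK : ∀ (ε : ℤˣ), ∀ k ∈ K, d (f y ^ (ε : ℤ) • p) (f k • f y ^ (ε : ℤ) • p) = 0 →
      (y ^ (ε : ℤ))⁻¹ * k * y ^ (ε : ℤ) ∈ K)
    (hinj : ∀ k ∈ K, f k = 1 → k = 1) (hgen : K ⊔ Subgroup.zpowers y = ⊤) :
    Function.Injective f := by
  have hyε : ∀ ε : ℤˣ, d p (f y ^ (ε : ℤ) • p) = 1 := by
    intro ε
    rcases Int.units_eq_one_or ε with rfl | rfl
    · simpa using hy
    · simpa [hd.dist_inv_smul] using hy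
  have hstep : ∀ k ∈ K, ∀ (ε : ℤˣ) (w : F),
      gromovProd d p (f w • p) ((f y ^ (ε : ℤ))⁻¹ • p) ≤ 0 →
      1 ≤ gromovProd d p (f (k * y ^ (ε : ℤ) * w) • p) (f k • f y ^ (ε : ℤ) • p) := by
    intro k hk ε w h
    have e1 := hd.gromovProd_smul_add (f y ^ (ε : ℤ)) p (f w • p)
    rw [hyε] at e1
    rw [map_mul, map_mul, mul_smul, mul_smul, map_zpow, hd.gromovProd_smul_of_fix (hKp k hk)]
    omega
  have hmul : ∀ k ∈ K, ∀ w, IsReducedProd d p f K y w → IsReducedProd d p f K y (k * w) := by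
    rintro k hk w (⟨_, hk'⟩ | ⟨k', hk', ε, w, hw, h⟩)
    · exact .base _ (mul_mem hk hk')
    · rw [← mul_assoc, ← mul_assoc]
      exact .step _ (mul_mem hk hk') ε w hw h
  have hmuly : ∀ (ε : ℤˣ) (w), IsReducedProd d p f K y w →
      IsReducedProd d p f K y (y ^ (ε : ℤ) * w) := by
    intro ε w hw
    by_cases h : gromovProd d p (f w • p) ((f y ^ (ε : ℤ))⁻¹ • p) ≤ 0
    · simpa using IsReducedProd.step 1 K.one_mem ε w hw h
    rcases hw with ⟨_, hk⟩ | ⟨k, hk, δ, w, hw, h'⟩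
    · exfalso
      have := hd.gromovProd_le_left p (f w • p) ((f y ^ (ε : ℤ))⁻¹ • p)
      have := hKp w hk
      omega
    have h1 := hstep k hk δ w h'
    have h2 : d (f k • f y ^ (δ : ℤ) • p) ((f y ^ (ε : ℤ))⁻¹ • p) = 0 := by
      have e1 := hyε δ
      have e2 := hyε ε
      rw [← hd.dist_inv_smul] at e2
      have := hd.dist_smul (f k) p (f y ^ (δ : ℤ) • p)
      have := hd.dist_congr_right (hKp k hk) (f k • f y ^ (δ : ℤ) • p)
      have := hd.symm p (f k • f y ^ (δ : ℤ) • p)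
      have := hd.symm (f k • p) (f k • f y ^ (δ : ℤ) • p)
      have := hd.two_mul_gromovProd p (f k • f y ^ (δ : ℤ) • p) ((f y ^ (ε : ℤ))⁻¹ • p)
      have := hd.min_gromovProd_le p (f k • f y ^ (δ : ℤ) • p) (f (k * y ^ (δ : ℤ) * w) • p)
        ((f y ^ (ε : ℤ))⁻¹ • p)
      have := hd.gromovProd_comm p (f k • f y ^ (δ : ℤ) • p) (f (k * y ^ (δ : ℤ) * w) • p)
      have := hd.nonneg (f k • f y ^ (δ : ℤ) • p) ((f y ^ (ε : ℤ))⁻¹ • p)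
      omega
    rcases eq_or_ne δ ε with rfl | hne
    · exfalso
      refine hd.not_inversion (f y ^ (δ : ℤ) * f k) p ?_ ?_
      · rw [mul_smul, ← hyε δ]
        exact (hd.dist_congr_right (by rw [hd.dist_smul]; exact hKp k hk) _).symm
      · rw [mul_smul, mul_smul, ← hd.dist_smul (f y ^ (δ : ℤ))⁻¹, inv_smul_smul, hd.symm, ← h2,
          hd.symm, hd.symm _ ((f y ^ (δ : ℤ))⁻¹ • p)]
        exact (hd.dist_congr_right (by simpa only [hd.dist_smul] using hKp k hk) _).symm
    · obtain rfl : δ = -ε := by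
        rcases Int.units_eq_one_or ε with rfl | rfl <;>
          rcases Int.units_eq_one_or δ with rfl | rfl <;> simp_all
      have h3 := hK (-ε) k hk (by
        rw [hd.symm]; simpa using h2)
      have := hmul _ h3 w hw
      simpa [mul_assoc] using this
  have hall : ∀ w, IsReducedProd d p f K y w := by
    have hz : ∀ n : ℤ, ∀ w, IsReducedProd d p f K y w → IsReducedProd d p f K y (y ^ n * w) := by
      intro n
      induction n using Int.induction_on with
      | zero => simp
      | succ n ih =>
        intro w hw
        rw [zpow_add_one, mul_assoc]
        exact ih _ (by simpa using hmuly 1 w hw)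
      | pred n ih =>
        intro w hw
        rw [zpow_sub_one, mul_assoc]
        exact ih _ (by simpa using hmuly (-1) w hw)
    intro w
    have hw : w ∈ K ⊔ Subgroup.zpowers y := hgen ▸ Subgroup.mem_top w
    rw [Subgroup.sup_eq_closure] at hw
    induction hw using Subgroup.closure_induction_left with
    | one => exact .base 1 K.one_mem
    | mul_left x hx w _ ih =>
      rcases hx with hx | ⟨n, rfl⟩
      · exact hmul x hx w ih
      · exact hz n w ih
    | inv_mul_cancel x hx w _ ih =>
      rcases hx with hx | ⟨n, rfl⟩
      · exact hmul x⁻¹ (inv_mem hx) w ih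
      · simpa using hz (-n) w ih
  rw [injective_iff_map_eq_one]
  intro w hw
  rcases hall w with ⟨_, hk⟩ | ⟨k, hk, δ, w, hw, h'⟩
  · exact hinj w hk hw
  · exfalso
    have h1 := hstep k hk δ w h'
    rw [hw, one_smul] at h1
    have := hd.gromovProd_le_left p p (f k • f y ^ (δ : ℤ) • p)
    have := hd.self p
    omega

namespace IsPinchedAction

open Subgroup

variable {G X : Type*} [Group G] [MulAction G X] {d : X → X → ℤ} (hd : IsPinchedAction G d)
include hd

/-- The case of a translation `b` of length one along the only edge at `p` fixed by `a`. -/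
theorem injective_of_fix_of_dist_eq_one {a b : G} {p : X} (ha1 : a ≠ 1) (ha : d p (a • p) = 0)
    (hb : d p (b • p) = 1) (hab : d (b • p) (a • b • p) = 0)
    (hr : gromovProd d p (a • b⁻¹ • p) (b⁻¹ • p) ≤ 0) :
    Function.Injective (FreeGroup.lift ![a, b]) := by
  have hb' : d p (b⁻¹ • p) = 1 := by rw [hd.dist_inv_smul, hb]
  have ha'p : d p ((b⁻¹ * a * b) • p) = 0 := by
    rw [mul_assoc, mul_smul, ← hd.dist_smul b, smul_inv_smul, mul_smul, hab]
  have ha'r : d (b⁻¹ • p) ((b⁻¹ * a * b) • b⁻¹ • p) = 0 := by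
    rw [mul_smul, smul_inv_smul, mul_smul, hd.dist_smul, ha]
  have hne : a * (b⁻¹ * a * b) ≠ b⁻¹ * a * b * a := by
    intro h
    have h1 : d (a • b⁻¹ • p) ((b⁻¹ * a * b) • a • b⁻¹ • p) = 0 := by
      rw [smul_smul _ a, ← h, mul_smul, hd.dist_smul, ha'r]
    have h2 := hd.eq_one_of_fix _ _ _ h1 ha'r (by
      have := hd.two_mul_gromovProd p (a • b⁻¹ • p) (b⁻¹ • p)
      have := hd.dist_smul a p (b⁻¹ • p)
      have := hd.dist_congr_right ha (a • b⁻¹ • p)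
      have := hd.symm p (a • b⁻¹ • p)
      have := hd.symm (a • p) (a • b⁻¹ • p)
      omega)
    apply ha1
    simpa [mul_assoc, inv_mul_eq_one, eq_comm] using h2
  have hinj := hd.injective_of_fix _ _ p ha ha'p hne
  have hinj' := hd.injective_of_fix _ _ p ha'p ha hne.symm
  let f := FreeGroup.lift ![a, b]
  let x : FreeGroup (Fin 2) := FreeGroup.of 0
  let y : FreeGroup (Fin 2) := FreeGroup.of 1
  have hfx : f x = a := by simp [f, x]
  have hfy : f y = b := by simp [f, y]
  let ψ := FreeGroup.lift ![x, y⁻¹ * x * y]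
  have hfψ : ∀ w, f (ψ w) = FreeGroup.lift ![a, b⁻¹ * a * b] w := by
    have hψ : f.comp ψ = FreeGroup.lift ![a, b⁻¹ * a * b] := by
      ext i; fin_cases i <;> simp [ψ, hfx, hfy]
    exact fun w => DFunLike.congr_fun hψ w
  have hr' : (FreeGroup.lift ![a, b⁻¹ * a * b]).range = closure {a, b⁻¹ * a * b} := by
    rw [FreeGroup.range_lift_eq_closure]; simp [Set.pair_comm]
  have hK : ∀ k ∈ ψ.range, f k ∈ closure {a, b⁻¹ * a * b} := by
    rintro _ ⟨w, rfl⟩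
    rw [hfψ, ← hr']
    exact ⟨w, rfl⟩
  have hKinj : ∀ k ∈ ψ.range, ∀ k' ∈ ψ.range, f k = f k' → k = k' := by
    rintro _ ⟨w, rfl⟩ _ ⟨w', rfl⟩ h
    rw [hfψ, hfψ] at h
    rw [hinj h]
  have hx : x ∈ ψ.range := ⟨FreeGroup.of 0, by simp [ψ]⟩
  have hyx : y⁻¹ * x * y ∈ ψ.range := ⟨FreeGroup.of 1, by simp [ψ]⟩
  have hKp : ∀ k ∈ ψ.range, d p (f k • p) = 0 := by
    intro k hk
    have hle : closure {a, b⁻¹ * a * b} ≤ hd.stab p := by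
      rw [closure_le]
      rintro _ (rfl | rfl)
      exacts [ha, ha'p]
    exact hle (hK k hk)
  refine hd.injective_of_forall_fix (f := f) (p := p) (K := ψ.range) (y := y) hKp
    (by rw [hfy, hb]) ?_ (fun k hk h => hKinj k hk 1 (one_mem _) (by rw [h, _root_.map_one])) ?_
  · intro ε k hk h
    rw [hfy] at h
    rcases Int.units_eq_one_or ε with rfl | rfl
    · simp only [Units.val_one, zpow_one] at h ⊢
      obtain ⟨n, hn⟩ := FreeGroup.mem_zpowers_of_commute_of_lift_injective hinj (hK k hk)
        (hd.commute_of_fix _ _ p (b • p) hb (hKp k hk) h ha hab)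
      have hk' : k = x ^ n := hKinj k hk _ (zpow_mem hx n)
        (by rw [_root_.map_zpow, hfx]; exact hn.symm)
      have : y⁻¹ * k * y = (y⁻¹ * x * y) ^ n := by
        rw [hk']; simpa using (conj_zpow (a := y⁻¹) (b := x) (i := n)).symm
      rw [this]
      exact zpow_mem hyx n
    · simp only [Units.val_neg, Units.val_one, zpow_neg, zpow_one, inv_inv] at h ⊢
      obtain ⟨n, hn⟩ := FreeGroup.mem_zpowers_of_commute_of_lift_injective hinj'
        (by rw [closure_pair_comm]; exact hK k hk)
        (hd.commute_of_fix _ _ p (b⁻¹ • p) hb' (hKp k hk) h ha'p ha'r)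
      have hk' : k = (y⁻¹ * x * y) ^ n := hKinj k hk _ (zpow_mem hyx n) (by
        rw [_root_.map_zpow, _root_.map_mul, _root_.map_mul, _root_.map_inv, hfx, hfy]
        exact hn.symm)
      have : y * k * y⁻¹ = x ^ n := by
        rw [hk', ← conj_zpow]; group
      rw [this]
      exact zpow_mem hx n
  · rw [eq_top_iff, ← FreeGroup.closure_range_of, closure_le]
    rintro _ ⟨i, rfl⟩
    fin_cases i
    · exact mem_sup_left hx
    · exact mem_sup_right (mem_zpowers y)

end IsPinchedAction

namespace IsTreeAction

variable {G X : Type*} [Group G] [MulAction G X] {d : X → X → ℤ} (hd : IsTreeAction G d)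
include hd

theorem dist_smul_le_of_gromovProd_pos {s : G} {p m : X} (hm : d p m = 1)
    (h : 1 ≤ gromovProd d p m (s • p)) : d m (s • m) ≤ d p (s • p) := by
  have := hd.two_mul_gromovProd p m (s • p)
  have := hd.triangle m (s • p) (s • m)
  have := hd.dist_smul s p m
  omega

theorem dist_smul_add_two_le {s : G} {p m : X} (hm : d p m = 1) (hN : 2 ≤ d p (s • p))
    (h : 1 ≤ gromovProd d p m (s • p)) (h' : 1 ≤ gromovProd d p m (s⁻¹ • p)) :
    d m (s • m) + 2 ≤ d p (s • p) := by
  have := hd.gromovProd_smul_add s p m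
  have := hd.gromovProd_le_left p m (s⁻¹ • p)
  have := hd.two_mul_gromovProd p (s • m) (s • p)
  have := hd.dist_smul s m p
  have := hd.symm p m
  have := hd.min_gromovProd_le p m (s • p) (s • m)
  have := hd.gromovProd_comm p (s • p) (s • m)
  have := hd.two_mul_gromovProd p m (s • m)
  omega

end IsTreeAction

namespace IsPinchedAction

open Subgroup

variable {G X : Type*} [Group G] [MulAction G X] {d : X → X → ℤ} (hd : IsPinchedAction G d)
include hd

/-- An element `a` with a fixed point `p`, and a translation `b` for which no translate of
`b⁻¹ • p` by powers of `a` is on the side of `b • p`. -/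
theorem injective_of_forall_gromovProd_le_zero {a b : G} {p : X} (ha1 : a ≠ 1)
    (ha : d p (a • p) = 0) (hb : 0 < d p (b • p))
    (h : ∀ n : ℤ, gromovProd d p (a ^ n • b⁻¹ • p) (b • p) ≤ 0)
    (h' : ∀ n : ℤ, n ≠ 0 → gromovProd d p (a ^ n • b⁻¹ • p) (b⁻¹ • p) ≤ 0) :
    Function.Injective (FreeGroup.lift ![a, b]) := by
  obtain ⟨m, h1, h2⟩ := hd.exists_mem_segment p (b • p) 1 (by omega) (by omega)
  by_cases hm : d m (a • m) = 0
  · rcases (show 1 = d p (b • p) ∨ 1 < d p (b • p) by omega) with h3 | h3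
    · refine hd.injective_of_fix_of_dist_eq_one ha1 ha h3.symm ?_ (by simpa using h' 1 one_ne_zero)
      have := hd.dist_congr_right (show d m (b • p) = 0 by omega) (a • m)
      have := hd.dist_smul a m (b • p)
      have := hd.triangle (b • p) (a • m) (a • b • p)
      have := hd.symm (b • p) (a • m)
      have := hd.symm m (a • m)
      have := hd.nonneg (b • p) (a • b • p)
      omega
    · exact hd.injective_of_gromovProd_le (κ := 1) (μ := 0) ha (by omega) (by omega) (by omega)
        (fun n hn => hd.gromovProd_zpow_smul_le_one hn ha ha1) h' (by simpa using h)
  · refine hd.injective_of_gromovProd_le (κ := 0) (μ := 0) ha (by omega) (by omega) (by omega)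
      (fun n hn => ?_) h' (by simpa using h)
    by_contra! h3
    exact hm (hd.fix_segment hn ha h1 h2 h3)

/-- Generating pairs which contain an element with a fixed point. -/
theorem isCommOrFreePair_of_fix {S : Subgroup G} {a b : G} {p : X}
    (hS : closure {a, b} = S) (ha : d p (a • p) = 0) : IsCommOrFreePair S := by
  obtain ⟨N, hN⟩ := Int.eq_ofNat_of_zero_le (hd.nonneg p (b • p))
  induction N using Nat.strong_induction_on generalizing p a b with
  | _ N ih =>
  by_cases ha1 : a = 1
  · exact isCommOrFreePair_of_commute hS (by simp [ha1])
  by_cases hell : ∃ (n : ℤ) (q : X), d q ((b * a ^ n) • q) = 0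
  · obtain ⟨n, q, hq⟩ := hell
    exact hd.isCommOrFreePair_of_fix_of_fix ((closure_pair_mul_zpow a b n).trans hS) ha hq
  push Not at hell
  have hfix : ∀ n : ℤ, d (b • p) ((b * a ^ n) • p) = 0 := fun n => by
    rw [mul_smul, hd.dist_smul]; exact hd.dist_zpow_smul ha n
  have hL : ∀ n : ℤ, d p ((b * a ^ n) • p) = N := fun n => by
    rw [← hd.dist_congr_right (hfix n), hN]
  have hlt : ∀ n : ℤ, 2 * gromovProd d p (a ^ n • b⁻¹ • p) (b • p) < N := by
    intro n
    by_contra! h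
    obtain ⟨q, hq⟩ := hd.exists_fix (s := b * a ^ (-n)) (p := p) (by
      rw [hL, ← hd.gromovProd_congr_left (hfix _), mul_inv_rev, zpow_neg, inv_inv, mul_smul,
        hd.gromovProd_comm]
      exact h)
    exact hell _ q hq
  have hN0 : 0 < N := by
    have := hlt 0
    have := hd.gromovProd_nonneg p (a ^ (0 : ℤ) • b⁻¹ • p) (b • p)
    omega
  by_cases hpos : ∃ n : ℤ, 0 < gromovProd d p (a ^ n • b⁻¹ • p) (b • p)
  · obtain ⟨n, hn⟩ := hpos
    set b' := b * a ^ (-n) with hb'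
    have e1 : ∀ k : ℤ, a ^ k • b'⁻¹ • p = a ^ (k + n) • b⁻¹ • p := fun k => by
      rw [hb', mul_inv_rev, zpow_neg, inv_inv, mul_smul, smul_smul, ← zpow_add]
    have e2 : ∀ x, gromovProd d p x (b' • p) = gromovProd d p x (b • p) := fun x =>
      (hd.gromovProd_congr_right (hfix _) x).symm
    have hS' : closure {a, b'} = S := (closure_pair_mul_zpow a b (-n)).trans hS
    have hc : 0 < gromovProd d p (b'⁻¹ • p) (b' • p) := by
      have := e1 0
      rw [zpow_zero, one_smul, zero_add] at this
      rw [e2, this]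
      exact hn
    have hlt' : ∀ k : ℤ, 2 * gromovProd d p (a ^ k • b'⁻¹ • p) (b' • p) < N := fun k => by
      rw [e1, e2]; exact hlt _
    have hN' : d p (b' • p) = N := hL _
    have hlt0 := hlt' 0
    rw [zpow_zero, one_smul] at hlt0
    obtain ⟨m, h1, h2⟩ := hd.exists_mem_segment p (b' • p) 1 (by omega) (by omega)
    by_cases hm : d m (a • m) = 0
    · have h3 := hd.gromovProd_eq_of_mem_segment h1 h2
      have h4 := hd.dist_smul_add_two_le (s := b') h1 (by omega) h3.ge (by
        have := hd.min_gromovProd_le p m (b' • p) (b'⁻¹ • p)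
        have := hd.gromovProd_comm p (b' • p) (b'⁻¹ • p)
        omega)
      have := hd.nonneg m (b' • m)
      refine ih (d m (b' • m)).toNat (by omega) hS' hm ?_
      omega
    have h3 : ∀ k : ℤ, k ≠ 0 → gromovProd d p (a ^ k • b' • p) (b' • p) ≤ 0 := fun k hk => by
      by_contra! h
      exact hm (hd.fix_segment hk ha h1 h2 h)
    have h4 : ∀ k : ℤ, k ≠ 0 → gromovProd d p (a ^ k • b'⁻¹ • p) (b' • p) ≤ 0 := fun k hk => by
      by_contra! h
      have := h3 k hk
      have := hd.min_gromovProd_le p (a ^ k • b' • p) (a ^ k • b'⁻¹ • p) (b' • p)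
      have := hd.gromovProd_smul_of_fix (hd.dist_zpow_smul ha k) (b' • p) (b'⁻¹ • p)
      have := hd.gromovProd_comm p (b' • p) (b'⁻¹ • p)
      omega
    refine isCommOrFreePair_of_injective hS' (hd.injective_of_gromovProd_le
      (κ := gromovProd d p (b'⁻¹ • p) (b' • p)) (μ := gromovProd d p (b'⁻¹ • p) (b' • p))
      ha hc.le hc.le (by omega) (fun k hk => (h3 k hk).trans hc.le) (fun k hk => ?_) (fun k => ?_))
    · have := h4 k hk
      have := hd.min_gromovProd_le p (a ^ k • b'⁻¹ • p) (b'⁻¹ • p) (b' • p)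
      omega
    · rw [min_self]
      rcases eq_or_ne k 0 with rfl | hk
      · simp
      · exact (h4 k hk).trans hc.le
  · push Not at hpos
    by_cases hA : ∀ n : ℤ, n ≠ 0 → gromovProd d p (a ^ n • b⁻¹ • p) (b⁻¹ • p) ≤ 0
    · exact isCommOrFreePair_of_injective hS
        (hd.injective_of_forall_gromovProd_le_zero ha1 ha (by omega) hpos hA)
    by_cases hB : ∀ n : ℤ, n ≠ 0 → gromovProd d p (a ^ n • b • p) (b • p) ≤ 0
    · refine isCommOrFreePair_of_injective ((closure_pair_inv a b).trans hS)
        (hd.injective_of_forall_gromovProd_le_zero ha1 ha (by rw [hd.dist_inv_smul]; omega)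
        (fun n => ?_) (by simpa only [inv_inv] using hB))
      rw [inv_inv, ← hd.gromovProd_smul_of_fix (hd.dist_zpow_smul ha (-n)), smul_smul, ← zpow_add,
        neg_add_cancel, zpow_zero, one_smul, hd.gromovProd_comm]
      exact hpos _
    exfalso
    push Not at hA hB
    obtain ⟨k, hk, hk'⟩ := hA
    obtain ⟨n, hn, hn'⟩ := hB
    have hL' := hd.dist_inv_smul b p
    obtain ⟨m, h1, h2⟩ := hd.exists_mem_segment p (b • p) 1 (by omega) (by omega)
    obtain ⟨m', h3, h4⟩ := hd.exists_mem_segment p (b⁻¹ • p) 1 (by omega) (by omega)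
    have h5 := hd.fix_segment hn ha h1 h2 hn'
    have h6 := hd.fix_segment hk ha h3 h4 hk'
    refine ha1 (hd.eq_one_of_fix a m m' h5 h6 ?_)
    have := hpos 0
    rw [zpow_zero, one_smul] at this
    have := hd.gromovProd_eq_of_mem_segment h1 h2
    have := hd.gromovProd_eq_of_mem_segment h3 h4
    have := hd.min_gromovProd_le p (b⁻¹ • p) m' (b • p)
    have := hd.min_gromovProd_le p m' m (b • p)
    have := hd.gromovProd_comm p (b⁻¹ • p) m'
    have := hd.gromovProd_comm p m m'
    have := hd.two_mul_gromovProd p m m'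
    omega

end IsPinchedAction

/-- `(a, b)` is a generating pair of `S` with minimal displacement `N`, and `S` has no generating
pair that contains an element with a fixed point. -/
structure IsMinimalPair {G X : Type*} [Group G] [MulAction G X] (d : X → X → ℤ) (S : Subgroup G)
    (p : X) (N : ℤ) (a b : G) : Prop where
  closure_eq : Subgroup.closure {a, b} = S
  add_eq : d p (a • p) + d p (b • p) = N
  le_add : ∀ (q : X) (a' b' : G), Subgroup.closure {a', b'} = S →
    N ≤ d q (a' • q) + d q (b' • q)
  pos : ∀ (q : X) (a' b' : G), Subgroup.closure {a', b'} = S → 0 < d q (a' • q)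

namespace IsMinimalPair

open Subgroup

variable {G X : Type*} [Group G] [MulAction G X] {d : X → X → ℤ} (hd : IsTreeAction G d)
  {S : Subgroup G} {p : X} {N : ℤ} {a b : G}

theorem symm (h : IsMinimalPair d S p N a b) : IsMinimalPair d S p N b a where
  closure_eq := by rw [closure_pair_comm]; exact h.closure_eq
  add_eq := by rw [add_comm]; exact h.add_eq
  le_add := h.le_add
  pos := h.pos

include hd

theorem inv_right (h : IsMinimalPair d S p N a b) : IsMinimalPair d S p N a b⁻¹ where
  closure_eq := by rw [closure_pair_inv]; exact h.closure_eq
  add_eq := by rw [hd.dist_inv_smul]; exact h.add_eq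
  le_add := h.le_add
  pos := h.pos

theorem two_mul_gromovProd_lt (h : IsMinimalPair d S p N a b) :
    2 * gromovProd d p (a • p) (a⁻¹ • p) < d p (a • p) := by
  by_contra! h1
  obtain ⟨q, hq⟩ := hd.exists_fix h1
  have := h.pos q a b h.closure_eq
  omega

theorem two_mul_gromovProd_le (h : IsMinimalPair d S p N a b) :
    2 * gromovProd d p (a • p) (b • p) ≤ d p (a • p) ∧
      2 * gromovProd d p (a • p) (b • p) ≤ d p (b • p) := by
  have h1 := h.le_add p a (a⁻¹ * b) ((closure_pair_inv_mul a b).trans h.closure_eq)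
  have h2 := h.le_add p b (b⁻¹ * a) ((closure_pair_inv_mul b a).trans h.symm.closure_eq)
  have h3 := h.add_eq
  rw [mul_smul, ← hd.dist_smul_left] at h1
  rw [mul_smul, ← hd.dist_smul_left] at h2
  have := hd.symm (a • p) (b • p)
  have := hd.two_mul_gromovProd p (a • p) (b • p)
  omega

theorem not_gromovProd_pos (h : IsMinimalPair d S p N a b)
    (h1 : 0 < gromovProd d p (a⁻¹ • p) (a • p)) (h2 : 0 < gromovProd d p (a • p) (b • p)) :
    False := by
  have h0 := h.two_mul_gromovProd_lt hd
  have := hd.gromovProd_comm p (a⁻¹ • p) (a • p)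
  obtain ⟨m, h3, h4⟩ := hd.exists_mem_segment p (a • p) 1 (by omega) (by omega)
  have h5 := hd.gromovProd_eq_of_mem_segment h3 h4
  have := hd.min_gromovProd_le p m (a • p) (a⁻¹ • p)
  have := hd.min_gromovProd_le p m (a • p) (b • p)
  have := hd.dist_smul_add_two_le (s := a) h3 (by omega) (by omega) (by omega)
  have := hd.dist_smul_le_of_gromovProd_pos (s := b) h3 (by omega)
  have := h.le_add m a b h.closure_eq
  have := h.add_eq
  omega

theorem not_eq_and_eq (h : IsMinimalPair d S p N a b) :
    ¬ (2 * gromovProd d p (a • p) (b • p) = d p (a • p) ∧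
      2 * gromovProd d p (a⁻¹ • p) (b⁻¹ • p) = d p (a • p)) := by
  rintro ⟨h1, h2⟩
  have hle := h.two_mul_gromovProd_le hd
  have hpos := h.pos p a b h.closure_eq
  have h3 := hd.two_mul_gromovProd p (a • p) (b • p)
  have h' : IsMinimalPair d S p N a (a⁻¹ * b) := by
    refine ⟨(closure_pair_inv_mul a b).trans h.closure_eq, ?_, h.le_add, h.pos⟩
    rw [mul_smul, ← hd.dist_smul_left]
    have := h.add_eq
    omega
  have e1 := hd.gromovProd_smul_add a⁻¹ p (b • p)
  have e2 := hd.gromovProd_smul_add b⁻¹ p (a • p)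
  rw [inv_inv, hd.dist_inv_smul, smul_smul] at e1 e2
  have e3 := hd.gromovProd_comm p (a • p) (b • p)
  have e4 := hd.gromovProd_comm p (a⁻¹ • p) (b⁻¹ • p)
  have e5 := hd.gromovProd_comm p (a⁻¹ • p) ((a⁻¹ * b) • p)
  have e6 := hd.min_gromovProd_le p ((b⁻¹ * a) • p) (b⁻¹ • p) (a⁻¹ • p)
  have e7 := hd.min_gromovProd_le p ((b⁻¹ * a) • p) (a⁻¹ • p) ((a⁻¹ * b) • p)
  have e8 : (a⁻¹ * b)⁻¹ = b⁻¹ * a := by group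
  refine (h'.symm.inv_right hd).not_gromovProd_pos hd ?_ ?_
  · rw [e8]
    omega
  · omega

/-- The small cancellation inequality between generators. -/
theorem gromovProd_add_gromovProd_lt (h : IsMinimalPair d S p N a b) :
    ∀ x ∈ ({a⁻¹, b, b⁻¹} : Set G), ∀ y ∈ ({a, b, b⁻¹} : Set G),
      gromovProd d p (a • p) (x • p) + gromovProd d p (a⁻¹ • p) (y • p) < d p (a • p) := by
  have ha := h.two_mul_gromovProd_lt hd
  have h1 := h.two_mul_gromovProd_le hd
  have h2 := (h.inv_right hd).two_mul_gromovProd_le hd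
  have h' := (h.symm.inv_right hd).symm
  have h3 := h'.two_mul_gromovProd_le hd
  have h4 := (h'.inv_right hd).two_mul_gromovProd_le hd
  have e1 := h.not_eq_and_eq hd
  have e2 := (h.inv_right hd).not_eq_and_eq hd
  have e3 := hd.min_gromovProd_le p (a • p) (b • p) (a⁻¹ • p)
  have e4 := hd.min_gromovProd_le p (a • p) (b⁻¹ • p) (a⁻¹ • p)
  have e5 := hd.gromovProd_comm p (a⁻¹ • p) (b • p)
  have e6 := hd.gromovProd_comm p (a⁻¹ • p) (b⁻¹ • p)
  have e7 := hd.gromovProd_comm p (a⁻¹ • p) (a • p)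
  simp only [hd.dist_inv_smul, inv_inv] at *
  rintro x (rfl | rfl | rfl) y (rfl | rfl | rfl) <;> omega

end IsMinimalPair

namespace IsTreeAction

open scoped Pointwise

variable {G : Type} {X : Type*} [Group G] [MulAction G X] {d : X → X → ℤ} (hd : IsTreeAction G d)
include hd

/-- Ping-pong for a family of translations whose axes have small overlaps. -/
theorem lift_injective_of_gromovProd_add_lt {ι : Type} [Nontrivial ι] {a : ι → G} {p : X}
    (h : ∀ i j k : ι, ∀ δ ε : ℤˣ, ∀ σ : ℤˣ, (j, δ) ≠ (i, σ) → (k, ε) ≠ (i, -σ) →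
      gromovProd d p (a i ^ (σ : ℤ) • p) (a j ^ (δ : ℤ) • p) +
        gromovProd d p (a i ^ ((-σ : ℤˣ) : ℤ) • p) (a k ^ (ε : ℤ) • p) < d p (a i • p)) :
    Function.Injective (FreeGroup.lift a) := by
  let Y : ι × ℤˣ → Set X := fun l => {x | ∀ l', l' ≠ l →
    gromovProd d p (a l.1 ^ (l.2 : ℤ) • p) (a l'.1 ^ (l'.2 : ℤ) • p) <
      gromovProd d p x (a l.1 ^ (l.2 : ℤ) • p)}
  have hL : ∀ i (σ : ℤˣ), d p (a i ^ (σ : ℤ) • p) = d p (a i • p) := by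
    intro i σ
    rcases Int.units_eq_one_or σ with rfl | rfl <;> simp [hd.dist_inv_smul]
  have hne : ∀ l, (Y l).Nonempty := by
    rintro ⟨i, σ⟩
    refine ⟨a i ^ (σ : ℤ) • p, ?_⟩
    rintro ⟨j, δ⟩ hl
    have h1 := h i j i δ σ σ hl (by
      intro h; rcases Int.units_eq_one_or σ with rfl | rfl <;> simp at h)
    simp only [hd.gromovProd_self, hL]
    have := hd.gromovProd_nonneg p (a i ^ ((-σ : ℤˣ) : ℤ) • p) (a i ^ (σ : ℤ) • p)
    omega
  have hdisj : ∀ l l', l ≠ l' → Disjoint (Y l) (Y l') := by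
    intro l l' hl
    rw [Set.disjoint_left]
    intro x hx hx'
    have h1 := hx l' hl.symm
    have h2 := hx' l hl
    have := hd.min_gromovProd_le p (a l.1 ^ (l.2 : ℤ) • p) x (a l'.1 ^ (l'.2 : ℤ) • p)
    have := hd.gromovProd_comm p (a l.1 ^ (l.2 : ℤ) • p) x
    have := hd.gromovProd_comm p (a l.1 ^ (l.2 : ℤ) • p) (a l'.1 ^ (l'.2 : ℤ) • p)
    omega
  have hmap : ∀ i (σ : ℤˣ), ∀ x ∉ Y (i, -σ), a i ^ (σ : ℤ) • x ∈ Y (i, σ) := by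
    rintro i σ x hx ⟨j, δ⟩ hl
    simp only [Y, Set.mem_ofPred_eq] at hx
    push Not at hx
    obtain ⟨⟨k, ε⟩, hk, hx⟩ := hx
    have h1 := h i j k δ ε σ hl hk
    have h2 := hd.gromovProd_smul_add (a i ^ (σ : ℤ)) p x
    rw [hL] at h2
    rw [Units.val_neg, zpow_neg] at h1 hx
    simp only at hx ⊢
    omega
  refine FreeGroup.injective_lift_of_ping_pong a (fun i => Y (i, 1)) (fun i => Y (i, -1))
    (fun i => hne _) ?_ ?_ ?_ ?_ ?_
  · exact fun i j hij => hdisj _ _ (by simpa using hij)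
  · exact fun i j hij => hdisj _ _ (by simpa using hij)
  · exact fun i j => hdisj _ _ (by simp)
  · rintro i _ ⟨x, hx, rfl⟩
    simpa using hmap i 1 x hx
  · rintro i _ ⟨x, hx, rfl⟩
    simpa using hmap i (-1) x (by simpa using hx)

end IsTreeAction

theorem IsMinimalPair.injective {G : Type} {X : Type*} [Group G] [MulAction G X] {d : X → X → ℤ}
    (hd : IsTreeAction G d) {S : Subgroup G} {p : X} {N : ℤ} {a b : G}
    (h : IsMinimalPair d S p N a b) : Function.Injective (FreeGroup.lift ![a, b]) := by
  have h1 := h.gromovProd_add_gromovProd_lt hd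
  have h2 := h.symm.gromovProd_add_gromovProd_lt hd
  simp only [Set.mem_insert_iff, Set.mem_singleton_iff, forall_eq_or_imp, forall_eq] at h1 h2
  refine hd.lift_injective_of_gromovProd_add_lt (p := p) ?_
  intro i j k δ ε σ hj hk
  rcases Int.units_eq_one_or σ with rfl | rfl <;> rcases Int.units_eq_one_or δ with rfl | rfl <;>
    rcases Int.units_eq_one_or ε with rfl | rfl <;> fin_cases i <;> fin_cases j <;> fin_cases k <;>
    simp at hj hk ⊢ <;> omega

open Subgroup in
/-- A group with a pinched action on a tree has only abelian and free two-generated subgroups. -/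
theorem IsPinchedAction.isCommOrFreePair {G : Type} {X : Type*} [Group G] [MulAction G X]
    {d : X → X → ℤ} (hd : IsPinchedAction G d) [Nonempty X] (a b : G) :
    IsCommOrFreePair (closure {a, b}) := by
  classical
  set S := closure {a, b} with hS
  by_contra hne
  let P : ℕ → Prop := fun N => ∃ (p : X) (a b : G), closure {a, b} = S ∧
    d p (a • p) + d p (b • p) = N
  have hP : ∃ N, P N := by
    obtain ⟨p⟩ := ‹Nonempty X›
    have := hd.nonneg p (a • p)
    have := hd.nonneg p (b • p)
    exact ⟨(d p (a • p) + d p (b • p)).toNat, p, a, b, hS.symm, by omega⟩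
  obtain ⟨p, a', b', hab, hN⟩ := Nat.find_spec hP
  refine hne (isCommOrFreePair_of_injective hab
    (IsMinimalPair.injective (p := p) (S := S) hd.toIsTreeAction ⟨hab, hN, ?_, ?_⟩))
  · intro q c e hce
    have := hd.nonneg q (c • q)
    have := hd.nonneg q (e • q)
    have := Nat.find_min' hP (m := (d q (c • q) + d q (e • q)).toNat) ⟨q, c, e, hce, by omega⟩
    omega
  · intro q c e hce
    refine lt_of_le_of_ne (hd.nonneg _ _) fun h => hne (hd.isCommOrFreePair_of_fix hce h.symm)

/-- A distance function with values in `ℤ` which has a unique first step towards each point is the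
distance function of a tree. -/
theorem IsTreeDist.of_unique_step {X : Type*} {d : X → X → ℤ} (self : ∀ x, d x x = 0)
    (symm : ∀ x y, d x y = d y x) (nonneg : ∀ x y, 0 ≤ d x y)
    (triangle : ∀ x y z, d x z ≤ d x y + d y z) (parity : ∀ x y z, Even (d x y + d y z + d x z))
    (exists_step : ∀ x y, 0 < d x y → ∃ m, d x m = 1 ∧ d m y = d x y - 1)
    (unique_step : ∀ x y m m', d x m = 1 → d m y = d x y - 1 → d x m' = 1 →
      d m' y = d x y - 1 → d m m' = 0) : IsTreeDist d := by
  have step_cases : ∀ x y m, d y m = 1 → d x m = d x y + 1 ∨ d x m = d x y - 1 := by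
    intro x y m h
    have := triangle x y m
    have := triangle x m y
    have := symm y m
    obtain ⟨k, hk⟩ := parity x y m
    omega
  have additive : ∀ n : ℕ, ∀ x y m p, d y p = n → d y m = 1 → d m p = d y p - 1 →
      d x m = d x y + 1 → d x p = d x y + d y p := by
    intro n
    induction n with
    | zero =>
      intro x y m p h1 h2 h3 h4
      have := nonneg m p
      simp only [Nat.cast_zero] at h1
      omega
    | succ n ih =>
      intro x y m p h1 h2 h3 h4
      rcases (nonneg m p).eq_or_lt with h0 | h0
      · have := triangle x m p
        have := triangle x p m
        have := symm m p
        omega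
      · obtain ⟨m', h5, h6⟩ := exists_step m p h0
        rcases step_cases x m m' h5 with h7 | h7
        · have := ih x m m' p (by push_cast at h1; omega) h5 h6 h7
          omega
        · have h8 := unique_step m x y m' (by rw [symm, h2]) (by rw [symm y, symm m]; omega) h5
            (by rw [symm m', symm m]; omega)
          have := triangle y m' p
          omega
  have main : ∀ n : ℕ, ∀ p x y z, d p y = n →
      d x z + d p y ≤ max (d x y + d p z) (d y z + d p x) := by
    intro n
    induction n with
    | zero =>
      intro p x y z h
      have := triangle x y z
      have := triangle y p z
      have := symm p y
      simp only [Nat.cast_zero] at h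
      omega
    | succ n ih =>
      intro p x y z h
      have hs := symm p x
      have := triangle x p z
      by_cases h1 : d x y = d p x + d p y
      · omega
      by_cases h2 : d z y = d p z + d p y
      · have := symm z y
        omega
      obtain ⟨m, h3, h4⟩ := exists_step p y (by push_cast at h; omega)
      have h5 : d x m = d x p - 1 := (step_cases x p m h3).resolve_left fun e =>
        h1 (by rw [additive _ x p m y h h3 h4 e, hs])
      have h6 : d z m = d z p - 1 := (step_cases z p m h3).resolve_left fun e =>
        h2 (by rw [additive _ z p m y h h3 h4 e, symm p z])
      have := ih m x y z (by push_cast at h; omega)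
      have := symm m x
      have := symm m z
      have := symm p z
      omega
  exact ⟨self, symm, nonneg, parity, fun p x y z => main _ p x y z
    (Int.toNat_of_nonneg (nonneg p y)).symm, exists_step⟩

namespace HNNExtension

open NormalWord

variable {K : Type*} [Group K] {A B : Subgroup K} (φ : A ≃* B)

theorem exists_reducedWord (g : HNNExtension K A B φ) :
    ∃ w : ReducedWord K A B, w.prod φ = g := by
  obtain ⟨d⟩ := TransversalPair.nonempty K A B
  exact ⟨(g • (NormalWord.empty : NormalWord d)).toReducedWord, by simp [prod_smul]⟩

variable {φ}

/-- The number of occurrences of the stable letter in a reduced word for `g`. -/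
noncomputable def length (g : HNNExtension K A B φ) : ℕ :=
  (exists_reducedWord φ g).choose.toList.length

theorem length_prod (w : ReducedWord K A B) : length (w.prod φ) = w.toList.length := by
  have := (ReducedWord.map_fst_eq_and_of_prod_eq φ (exists_reducedWord φ (w.prod φ)).choose_spec).1
  simpa [length] using congrArg List.length this

theorem length_of_mul (h : K) (g : HNNExtension K A B φ) : length (of h * g) = length g := by
  obtain ⟨w, rfl⟩ := exists_reducedWord φ g
  have : of h * w.prod φ = ReducedWord.prod φ ⟨h * w.head, w.toList, w.chain⟩ := by
    simp [ReducedWord.prod, mul_assoc]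
  rw [this, length_prod, length_prod]

theorem t_zpow_mul_of (u : ℤˣ) (a : toSubgroup A B u) :
    t ^ (u : ℤ) * of (a : K) = (of (toSubgroupEquiv φ u a : K) * t ^ (u : ℤ) :
      HNNExtension K A B φ) := by
  rcases Int.units_eq_one_or u with rfl | rfl
  · rw [Units.val_one, zpow_one]
    exact t_mul_of (φ := φ) a
  · rw [Units.val_neg, Units.val_one, zpow_neg, zpow_one]
    exact inv_t_mul_of (φ := φ) a

theorem length_one : length (1 : HNNExtension K A B φ) = 0 := by
  simpa [ReducedWord.prod] using length_prod (φ := φ) (ReducedWord.empty K A B)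

theorem length_of (h : K) : length (of h : HNNExtension K A B φ) = 0 := by
  simpa [length_one] using length_of_mul h (1 : HNNExtension K A B φ)

theorem length_eq_zero {g : HNNExtension K A B φ} (hg : length g = 0) : ∃ h, g = of h := by
  obtain ⟨w, rfl⟩ := exists_reducedWord φ g
  rw [length_prod, List.length_eq_zero_iff] at hg
  exact ⟨w.head, by simp [ReducedWord.prod, hg]⟩

/-- The decomposition of an element at the first occurrence of the stable letter in a reduced
word. -/
theorem exists_eq_of_mul_t_zpow_mul {g : HNNExtension K A B φ} (hg : length g ≠ 0) :
    ∃ (h : K) (u : ℤˣ) (g' : HNNExtension K A B φ), g = of h * t ^ (u : ℤ) * g' ∧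
      length g = length g' + 1 ∧ ∀ (v : ℤˣ) (k : K),
        length (t ^ (v : ℤ) * of k * g) ≠ length g + 1 → v = -u ∧ k * h ∈ toSubgroup A B v := by
  obtain ⟨⟨h, l, c⟩, rfl⟩ := exists_reducedWord φ g
  rw [length_prod] at hg
  cases l with
  | nil => simp at hg
  | cons a l =>
    refine ⟨h, a.1, ReducedWord.prod φ ⟨a.2, l, (List.isChain_cons.1 c).2⟩,
      by simp [ReducedWord.prod, mul_assoc], by simp [length_prod], fun v k hv => ?_⟩
    by_contra H
    apply hv
    have : t ^ (v : ℤ) * of k * ReducedWord.prod φ ⟨h, a :: l, c⟩ =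
        ReducedWord.prod φ ⟨1, (v, k * h) :: a :: l, by
          refine List.isChain_cons.2 ⟨fun b hb hm => ?_, c⟩
          obtain rfl : a = b := by simpa using hb
          by_contra hne
          exact H ⟨by simpa using Int.units_ne_iff_eq_neg.1 hne, hm⟩⟩ := by
      simp [ReducedWord.prod, mul_assoc]
    rw [this, length_prod, length_prod]
    simp

theorem length_t_zpow (v : ℤˣ) : length (t ^ (v : ℤ) : HNNExtension K A B φ) = 1 := by
  simpa [ReducedWord.prod] using length_prod (φ := φ) ⟨1, [(v, 1)], List.isChain_singleton _⟩

theorem t_zpow_neg_mul_of_mul_t_zpow {v : ℤˣ} {k : K} (hk : k ∈ toSubgroup A B (-v)) :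
    ∃ k', (t ^ (-v : ℤ) * of k * t ^ (v : ℤ) : HNNExtension K A B φ) = of k' := by
  refine ⟨toSubgroupEquiv φ (-v) ⟨k, hk⟩, ?_⟩
  have := t_zpow_mul_of (φ := φ) (-v) ⟨k, hk⟩
  simp only [Units.val_neg] at this
  rw [this]
  simp [mul_assoc]

theorem length_t_zpow_mul (v : ℤˣ) (g : HNNExtension K A B φ) :
    length (t ^ (v : ℤ) * g) = length g + 1 ∨ length (t ^ (v : ℤ) * g) + 1 = length g := by
  by_cases hg : length g = 0
  · obtain ⟨h, rfl⟩ := length_eq_zero hg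
    left
    simpa [ReducedWord.prod, length_of] using
      length_prod (φ := φ) ⟨1, [(v, h)], List.isChain_singleton _⟩
  · obtain ⟨h, u, g', rfl, h1, h2⟩ := exists_eq_of_mul_t_zpow_mul hg
    rw [or_iff_not_imp_left]
    intro hv
    obtain ⟨rfl, hk⟩ := h2 v 1 (by simpa using hv)
    obtain ⟨k', hk'⟩ := t_zpow_neg_mul_of_mul_t_zpow (φ := φ) (v := u) (by simpa using hk)
    rw [h1, show t ^ ((-u : ℤˣ) : ℤ) * (of h * t ^ (u : ℤ) * g') = of k' * g' by
      rw [← hk']; simp [mul_assoc], length_of_mul]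

theorem length_t_zpow_mul_le (v : ℤˣ) (g : HNNExtension K A B φ) :
    length (t ^ (v : ℤ) * g) ≤ length g + 1 := by
  rcases length_t_zpow_mul v g with h | h <;> omega

/-- An induction principle for elements of an HNN extension. -/
theorem induction_length {P : HNNExtension K A B φ → Prop} (h0 : ∀ h, P (of h))
    (h1 : ∀ h (u : ℤˣ) g, length (of h * t ^ (u : ℤ) * g) = length g + 1 → P g →
      P (of h * t ^ (u : ℤ) * g)) (g : HNNExtension K A B φ) : P g := by
  induction hn : length g generalizing g with
  | zero => obtain ⟨h, rfl⟩ := length_eq_zero hn; exact h0 h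
  | succ n ih =>
    obtain ⟨h, u, g', rfl, h2, -⟩ := exists_eq_of_mul_t_zpow_mul (g := g) (by omega)
    exact h1 h u g' h2 (ih g' (by omega))

theorem length_mul_le (g g' : HNNExtension K A B φ) : length (g * g') ≤ length g + length g' := by
  induction g using induction_length with
  | h0 h => simp [length_of_mul, length_of]
  | h1 h u g hl ih =>
    have := length_t_zpow_mul_le u (g * g')
    rw [hl, mul_assoc, mul_assoc, length_of_mul]
    omega

theorem length_inv_le (g : HNNExtension K A B φ) : length g⁻¹ ≤ length g := by
  induction g using induction_length with
  | h0 h => simp [← map_inv, length_of]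
  | h1 h u g hl ih =>
    rw [hl, show (of h * t ^ (u : ℤ) * g)⁻¹ = g⁻¹ * (t ^ ((-u : ℤˣ) : ℤ) * of h⁻¹) by
      simp [mul_assoc]]
    have := length_mul_le g⁻¹ (t ^ ((-u : ℤˣ) : ℤ) * of h⁻¹)
    have := length_t_zpow_mul_le (φ := φ) (-u) (of h⁻¹)
    rw [length_of] at this
    omega

theorem length_inv (g : HNNExtension K A B φ) : length g⁻¹ = length g :=
  (length_inv_le g).antisymm (by simpa using length_inv_le g⁻¹)

theorem length_mul_of (g : HNNExtension K A B φ) (h : K) : length (g * of h) = length g := by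
  rw [← length_inv, mul_inv_rev, ← map_inv, length_of_mul, length_inv]

theorem mem_toSubgroup_of_length_eq_zero {v : ℤˣ} {k : K}
    (h : length (t ^ (-v : ℤ) * of k * t ^ (v : ℤ) : HNNExtension K A B φ) = 0) :
    k ∈ toSubgroup A B (-v) := by
  by_contra hk
  let w : ReducedWord K A B := ⟨1, [(-v, k), (v, 1)], by simp [hk]⟩
  have e : w.prod φ = t ^ (-v : ℤ) * of k * t ^ (v : ℤ) := by
    simp [w, ReducedWord.prod, mul_assoc]
  have := length_prod (φ := φ) w
  rw [e, h] at this
  simp [w] at this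

/-- The exponent sum of the stable letter. -/
def height : HNNExtension K A B φ →* Multiplicative ℤ :=
  lift 1 (Multiplicative.ofAdd 1) (by simp)

theorem even_length_add_height (g : HNNExtension K A B φ) :
    Even ((length g : ℤ) + (height g).toAdd) := by
  induction g using induction_length with
  | h0 h => simp [length_of, height]
  | h1 h u g hl ih =>
    rw [hl]
    obtain ⟨k, hk⟩ := ih
    rcases Int.units_eq_one_or u with rfl | rfl
    · exact ⟨k + 1, by simp [height] at *; omega⟩
    · exact ⟨k, by simp [height] at *; omega⟩

/-- The distance on the Bass–Serre tree of an HNN extension, with the vertex `g K` represented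
by the elements of this coset. -/
noncomputable def treeDist (x y : HNNExtension K A B φ) : ℤ := length (x⁻¹ * y)

theorem length_mul_eq_zero {x y : HNNExtension K A B φ} (hx : length x = 0) (hy : length y = 0) :
    length (x * y) = 0 := by
  have := length_mul_le x y
  omega

/-- A reduced word has a unique first vertex. -/
theorem length_inv_mul_eq_zero {m m' g : HNNExtension K A B φ} (h1 : length m = 1)
    (h2 : length (m⁻¹ * g) + 1 = length g) (h1' : length m' = 1)
    (h2' : length (m'⁻¹ * g) + 1 = length g) : length (m⁻¹ * m') = 0 := by
  obtain ⟨h, u, g', rfl, -, h4⟩ := exists_eq_of_mul_t_zpow_mul (g := g) (by omega)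
  have key : ∀ m : HNNExtension K A B φ, length m = 1 →
      length (m⁻¹ * (of h * t ^ (u : ℤ) * g')) + 1 = length (of h * t ^ (u : ℤ) * g') →
      length (m⁻¹ * (of h * t ^ (u : ℤ))) = 0 := by
    intro m h1 h2
    obtain ⟨k, v, m', rfl, h5, -⟩ := exists_eq_of_mul_t_zpow_mul (g := m) (by omega)
    obtain ⟨k', rfl⟩ := length_eq_zero (g := m') (by omega)
    have e : (of k * t ^ (v : ℤ) * of k')⁻¹ =
        (of k'⁻¹ * (t ^ ((-v : ℤˣ) : ℤ) * of k⁻¹) : HNNExtension K A B φ) := by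
      simp [mul_assoc]
    rw [e, mul_assoc, length_of_mul] at h2
    obtain ⟨h6, h7⟩ := h4 (-v) k⁻¹ (by omega)
    obtain rfl := neg_injective h6
    obtain ⟨c, hc⟩ := t_zpow_neg_mul_of_mul_t_zpow (φ := φ) h7
    rw [e, mul_assoc, length_of_mul]
    have : t ^ ((-v : ℤˣ) : ℤ) * of k⁻¹ * (of h * t ^ (v : ℤ)) = (of c : HNNExtension K A B φ) := by
      rw [← hc]; simp [mul_assoc]
    rw [this, length_of]
  have := length_mul_eq_zero (key m h1 h2) ((length_inv _).trans (key m' h1' h2'))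
  rwa [mul_inv_rev, inv_inv, ← mul_assoc, mul_assoc m⁻¹, mul_inv_cancel, mul_one] at this

theorem isTreeDist_treeDist : IsTreeDist (treeDist : _ → HNNExtension K A B φ → ℤ) := by
  apply IsTreeDist.of_unique_step
  · simp [treeDist, length_one]
  · intro x y
    rw [treeDist, ← length_inv]
    simp [treeDist]
  · simp [treeDist]
  · intro x y z
    have := length_mul_le (x⁻¹ * y) (y⁻¹ * z)
    simp only [mul_assoc, mul_inv_cancel_left] at this
    simp only [treeDist]
    omega
  · intro x y z
    obtain ⟨i, hi⟩ := even_length_add_height (x⁻¹ * y)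
    obtain ⟨j, hj⟩ := even_length_add_height (y⁻¹ * z)
    obtain ⟨k, hk⟩ := even_length_add_height (x⁻¹ * z)
    simp only [map_mul, map_inv, toAdd_mul, toAdd_inv] at hi hj hk
    simp only [treeDist]
    exact ⟨i + j + k + (height x).toAdd - (height z).toAdd, by omega⟩
  · intro x y hxy
    obtain ⟨h, u, g, e, h1, -⟩ := exists_eq_of_mul_t_zpow_mul (g := x⁻¹ * y)
      (by simp only [treeDist] at hxy; omega)
    refine ⟨x * (of h * t ^ (u : ℤ)), ?_, ?_⟩
    · simp [treeDist, length_of_mul, length_t_zpow]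
    · simp only [treeDist, h1]
      rw [mul_inv_rev, mul_assoc, e]
      simp [mul_assoc]
  · intro x y m m' h1 h2 h3 h4
    simp only [treeDist] at *
    have := length_inv_mul_eq_zero (m := x⁻¹ * m) (m' := x⁻¹ * m') (g := x⁻¹ * y) (by omega)
      (by simpa using (by omega : length (m⁻¹ * y) + 1 = length (x⁻¹ * y))) (by omega)
      (by simpa using (by omega : length (m'⁻¹ * y) + 1 = length (x⁻¹ * y)))
    simpa using this

theorem isTreeAction_treeDist :
    IsTreeAction (HNNExtension K A B φ) (treeDist : _ → HNNExtension K A B φ → ℤ) where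
  toIsTreeDist := isTreeDist_treeDist
  dist_smul g x y := by simp [treeDist, mul_assoc]
  not_inversion g x h1 h2 := by
    obtain ⟨i, hi⟩ := even_length_add_height (x⁻¹ * (g * x))
    simp only [treeDist, smul_eq_mul] at h1 h2
    obtain ⟨h, hh⟩ := length_eq_zero (g := x⁻¹ * (g * (g * x))) (by omega)
    have := congrArg (fun y => (height y).toAdd) hh
    simp only [map_mul, map_inv, toAdd_mul, toAdd_inv] at hi this
    simp [height] at hi this
    omega

end HNNExtension

namespace HNNExtension

theorem length_eq_one {K : Type*} [Group K] {A B : Subgroup K} {φ : A ≃* B}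
    {m : HNNExtension K A B φ} (hm : length m = 1) :
    ∃ (h : K) (e : ℤˣ) (k : K), m = of h * t ^ (e : ℤ) * of k := by
  obtain ⟨h, e, m', rfl, h5, -⟩ := exists_eq_of_mul_t_zpow_mul (g := m) (by omega)
  obtain ⟨k, rfl⟩ := length_eq_zero (g := m') (by omega)
  exact ⟨h, e, k, rfl⟩

theorem length_conj_eq_zero_iff {K : Type*} [Group K] {A B : Subgroup K} {φ : A ≃* B}
    (h g k : K) (e : ℤˣ) :
    length ((of h * t ^ (e : ℤ) * of k)⁻¹ * (of g * (of h * t ^ (e : ℤ) * of k)) :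
      HNNExtension K A B φ) = 0 ↔ h⁻¹ * g * h ∈ toSubgroup A B (-e) := by
  have : (of h * t ^ (e : ℤ) * of k)⁻¹ * (of g * (of h * t ^ (e : ℤ) * of k)) = (of k⁻¹ *
      (t ^ (-e : ℤ) * of (h⁻¹ * g * h) * t ^ (e : ℤ) * of k) : HNNExtension K A B φ) := by
    simp [mul_assoc]
  rw [this, length_of_mul, length_mul_of]
  refine ⟨mem_toSubgroup_of_length_eq_zero, fun hm => ?_⟩
  obtain ⟨c, hc⟩ := t_zpow_neg_mul_of_mul_t_zpow (φ := φ) hm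
  rw [hc, length_of]

theorem length_inv_mul_eq_zero_of_mem {K : Type*} [Group K] {A B : Subgroup K} {φ : A ≃* B}
    {h h' k k' : K} {e : ℤˣ} (hm : h⁻¹ * h' ∈ toSubgroup A B (-e)) :
    length ((of h * t ^ (e : ℤ) * of k)⁻¹ * (of h' * t ^ (e : ℤ) * of k') :
      HNNExtension K A B φ) = 0 := by
  have : (of h * t ^ (e : ℤ) * of k)⁻¹ * (of h' * t ^ (e : ℤ) * of k') = (of k⁻¹ *
      (t ^ (-e : ℤ) * of (h⁻¹ * h') * t ^ (e : ℤ) * of k') : HNNExtension K A B φ) := by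
    simp [mul_assoc]
  obtain ⟨c, hc⟩ := t_zpow_neg_mul_of_mul_t_zpow (φ := φ) hm
  rw [this, length_of_mul, length_mul_of, hc, length_of]

theorem exists_eq_conj {K : Type*} [Group K] {A B : Subgroup K} {φ : A ≃* B}
    {g x : HNNExtension K A B φ} (h : treeDist x (g • x) = 0) : ∃ c, g = x * of c * x⁻¹ := by
  obtain ⟨c, hc⟩ := length_eq_zero (g := x⁻¹ * (g * x)) (by simpa [treeDist] using h)
  exact ⟨c, by rw [← hc]; group⟩

variable {K : Type} [Group K] {u v : K} {φ : Subgroup.zpowers u ≃* Subgroup.zpowers v}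

theorem exists_toSubgroup_eq_zpowers (hu : u ≠ 1) (hv : v ≠ 1) (hup : ¬ IsProperPower u)
    (hvp : ¬ IsProperPower v) (e : ℤˣ) : ∃ w : K, w ≠ 1 ∧ ¬ IsProperPower w ∧
      toSubgroup (Subgroup.zpowers u) (Subgroup.zpowers v) e = Subgroup.zpowers w := by
  rcases Int.units_eq_one_or e with rfl | rfl
  · exact ⟨u, hu, hup, rfl⟩
  · exact ⟨v, hv, hvp, rfl⟩

theorem exists_edge_stabilizer (hu : u ≠ 1) (hv : v ≠ 1) (hup : ¬ IsProperPower u)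
    (hvp : ¬ IsProperPower v)
    {x y : HNNExtension K (Subgroup.zpowers u) (Subgroup.zpowers v) φ} (hxy : treeDist x y = 1) :
    ∃ w a : K, w ≠ 1 ∧ ¬ IsProperPower w ∧ ∀ c,
      treeDist y ((x * of c * x⁻¹) • y) = 0 ↔ a⁻¹ * c * a ∈ Subgroup.zpowers w := by
  obtain ⟨h, e, k, hk⟩ := length_eq_one (m := x⁻¹ * y) (by simpa [treeDist] using hxy)
  obtain ⟨w, hw, hwp, ew⟩ := exists_toSubgroup_eq_zpowers hu hv hup hvp (-e)
  refine ⟨w, h, hw, hwp, fun c => ?_⟩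
  rw [← ew, ← length_conj_eq_zero_iff (φ := φ) h c k e, ← hk]
  simp [treeDist, mul_assoc]

variable [IsFreeGroup K]

/-- An element which fixes two distinct neighbours of the base vertex is trivial. -/
theorem eq_one_of_length_conj (hu : u ≠ 1) (hv : v ≠ 1) (hup : ¬ IsProperPower u)
    (hvp : ¬ IsProperPower v) (huv : ¬ IsConj u v) (huv' : ¬ IsConj u v⁻¹) {g : K}
    {x y : HNNExtension K (Subgroup.zpowers u) (Subgroup.zpowers v) φ}
    (hx : length x = 1) (hy : length y = 1) (hxy : length (x⁻¹ * y) ≠ 0)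
    (hgx : length (x⁻¹ * (of g * x)) = 0) (hgy : length (y⁻¹ * (of g * y)) = 0) : g = 1 := by
  obtain ⟨h, e, k, rfl⟩ := length_eq_one hx
  obtain ⟨h', e', k', rfl⟩ := length_eq_one hy
  rw [length_conj_eq_zero_iff] at hgx hgy
  have key : ∀ a b : K, a⁻¹ * g * a ∈ Subgroup.zpowers u → b⁻¹ * g * b ∈ Subgroup.zpowers v →
      g = 1 := by
    intro a b ha hb
    have := IsFreeGroup.eq_one_of_conj_mem (h := b⁻¹ * a) hu hv hup hvp huv huv' ha
      (by simpa [mul_assoc] using hb)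
    simpa [mul_assoc, inv_mul_eq_one] using this
  by_cases he : e = e'
  · subst he
    by_contra hg
    apply hxy
    apply length_inv_mul_eq_zero_of_mem
    obtain ⟨w, hw, hwp, ew⟩ := exists_toSubgroup_eq_zpowers hu hv hup hvp (-e)
    rw [ew] at hgx hgy ⊢
    refine IsFreeGroup.mem_zpowers_of_conj_mem hw hwp ?_ hgy (by simpa [mul_assoc] using hgx)
    simpa [mul_assoc, inv_mul_eq_one] using hg
  · obtain rfl := Int.units_ne_iff_eq_neg.1 he
    rcases Int.units_eq_one_or e' with rfl | rfl
    · exact key h h' (by simpa using hgx) hgy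
    · exact key h' h (by simpa using hgy) hgx

theorem isPinchedAction_treeDist (hu : u ≠ 1) (hv : v ≠ 1) (hup : ¬ IsProperPower u)
    (hvp : ¬ IsProperPower v) (huv : ¬ IsConj u v) (huv' : ¬ IsConj u v⁻¹) :
    IsPinchedAction (HNNExtension K (Subgroup.zpowers u) (Subgroup.zpowers v) φ)
      (treeDist : _ → HNNExtension K (Subgroup.zpowers u) (Subgroup.zpowers v) φ → ℤ) where
  toIsTreeAction := isTreeAction_treeDist
  eq_one_of_fix g x y hx hy hxy := by
    have hd := isTreeAction_treeDist (φ := φ)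
    obtain ⟨m, h1, h2⟩ := hd.exists_step x y (by omega)
    obtain ⟨z, h3, h4⟩ := hd.exists_step m y (by omega)
    have fix : ∀ p m, treeDist p (g • p) = 0 → treeDist p m = 1 →
        treeDist m y = treeDist p y - 1 → treeDist m (g • m) = 0 := by
      intro p m hp h1 h2
      refine hd.dist_smul_eq_zero hp h1 h2 ?_
      rw [← hd.gromovProd_congr_left hy, hd.gromovProd_self]
      have := hd.nonneg m y
      omega
    have hm := fix x m hx h1 h2
    have hz := fix m z hm h3 h4
    have h5 := hd.triangle x z y
    have h6 := hd.symm x m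
    obtain ⟨c, rfl⟩ := exists_eq_conj hm
    have hc : c = 1 := by
      refine eq_one_of_length_conj (φ := φ) (x := m⁻¹ * x) (y := m⁻¹ * z) hu hv hup hvp huv huv'
        ?_ ?_ ?_ ?_ ?_
      · simp only [treeDist] at *
        omega
      · simp only [treeDist] at *
        omega
      · simp only [treeDist] at *
        simp only [mul_inv_rev, inv_inv, mul_assoc, mul_inv_cancel_left]
        omega
      · simpa [treeDist, mul_assoc] using hx
      · simpa [treeDist, mul_assoc] using hz
    simp [hc]
  fix_of_zpow_fix g x y n hxy hx hn hy := by
    obtain ⟨w, a, hw, hwp, H⟩ := exists_edge_stabilizer hu hv hup hvp hxy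
    obtain ⟨c, rfl⟩ := exists_eq_conj hx
    rw [conj_zpow, ← map_zpow, H] at hy
    rw [H]
    refine IsFreeGroup.mem_zpowers_of_zpow_mem hw hwp hn ?_
    have := conj_zpow (a := a⁻¹) (b := c) (i := n)
    rw [inv_inv] at this
    rwa [this]
  commute_of_fix g h x y hxy hx hy hx' hy' := by
    obtain ⟨w, a, -, -, H⟩ := exists_edge_stabilizer hu hv hup hvp hxy
    obtain ⟨c, rfl⟩ := exists_eq_conj hx
    obtain ⟨c', rfl⟩ := exists_eq_conj hx'
    rw [H] at hy hy'
    obtain ⟨i, hi⟩ := hy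
    obtain ⟨j, hj⟩ := hy'
    have hcc : c * c' = c' * c := by
      have e : c = a * w ^ i * a⁻¹ := by rw [show w ^ i = _ from hi]; group
      have e' : c' = a * w ^ j * a⁻¹ := by rw [show w ^ j = _ from hj]; group
      rw [e, e']
      simp only [conj_mul, ← zpow_add, add_comm i]
    simp only [conj_mul, ← map_mul, hcc]
  injective_of_fix g h x hg hh hgh := by
    obtain ⟨c, rfl⟩ := exists_eq_conj hg
    obtain ⟨c', rfl⟩ := exists_eq_conj hh
    have hcc : c * c' ≠ c' * c := by
      intro e
      apply hgh
      simp only [conj_mul, ← map_mul, e]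
    have : FreeGroup.lift ![x * of c * x⁻¹, x * of c' * x⁻¹] =
        ((MulAut.conj x).toMonoidHom.comp of).comp (FreeGroup.lift ![c, c']) := by
      ext i
      fin_cases i <;> simp
    rw [this]
    exact ((MulAut.conj x).injective.comp (of_injective φ)).comp
      (IsFreeGroup.lift_pair_injective hcc)

end HNNExtension

/-- **2-generated subgroups of conjugacy pinched one-relator groups.**
Let `H` be a free group, `u, v ∈ H` nontrivial, neither a proper power, and `u`
not conjugate to `v` or `v⁻¹`.  Let `G = ⟨H, t | tut⁻¹ = v⟩` be the HNN extension
of `H` along the isomorphism `⟨u⟩ ≃ ⟨v⟩` sending `u` to `v`.  Then every subgroup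
of `G` generated by at most two elements is abelian or free of rank two. -/
theorem twoGeneratedSubgroups_of_HNN
    (H : Type) [Group H] [IsFreeGroup H]
    (u v : H) (hu : u ≠ 1) (hv : v ≠ 1)
    (hup : ¬ IsProperPower u) (hvp : ¬ IsProperPower v)
    (huv : ¬ IsConj u v) (huv' : ¬ IsConj u v⁻¹)
    (φ : (Subgroup.zpowers u) ≃* (Subgroup.zpowers v))
    (hφ : φ ⟨u, Subgroup.mem_zpowers u⟩ = ⟨v, Subgroup.mem_zpowers v⟩)
    (x : Fin 2 → HNNExtension H (Subgroup.zpowers u) (Subgroup.zpowers v) φ) :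
    (∀ a b : ↥(Subgroup.closure (Set.range x)), a * b = b * a) ∨
      Nonempty (↥(Subgroup.closure (Set.range x)) ≃* FreeGroup (Fin 2)) := by
  have hx : Set.range x = {x 0, x 1} := by
    ext y
    simp [Fin.exists_fin_two, eq_comm]
  rw [hx]
  exact (HNNExtension.isPinchedAction_treeDist hu hv hup hvp huv huv').isCommOrFreePair (x 0) (x 1)
end
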